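/- arXiv:2104.14705 — 2 statements merged into one kernel-verified Lean document; each statement's English description precedes it below -/
import Mathlib

section
/- Suppose F(z|τ) and G(z|τ) are entire functions of z, odd in z, satisfying F(z|τ) = −F(z+π|τ) = −q^{3/2} e^{6iz} F(z+πτ|τ) and G(z|τ) = −G(z+π|τ) = −q^{3/2} e^{6iz} G(z+πτ|τ) for all z ∈ ℂ. Then there exists a constant C ∈ ℂ, independent of x and y, such that for all x, y ∈ ℂ: F(x|τ)G(y|τ) − F(y|τ)G(x|τ) = C·θ₁(x−y|τ)θ₁(x+y|τ)θ₁(x|τ)θ₁(y|τ). -/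
noncomputable section

open Complex

namespace Liu

/-- `π` as a complex number. -/
def piC : ℂ := Real.pi

/-- The nome `q = exp(2πiτ)`. -/
def qq (τ : ℂ) : ℂ := exp (2 * piC * I * τ)

/-- Jacobi theta function θ₁(z|τ). -/
def theta1 (z τ : ℂ) : ℂ :=
  -I * exp (piC * I * τ / 4) *
    ∑' n : ℤ, (-1 : ℂ) ^ n * exp (piC * I * τ * (n : ℂ) * ((n : ℂ) + 1)) *
      exp ((2 * (n : ℂ) + 1) * I * z)

/-- Jacobi theta function θ₂(z|τ). -/
def theta2 (z τ : ℂ) : ℂ :=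
  2 * ∑' n : ℕ, exp (piC * I * τ * (2 * (n : ℂ) + 1) ^ 2 / 4) * cos ((2 * (n : ℂ) + 1) * z)

/-- Jacobi theta function θ₃(z|τ). -/
def theta3 (z τ : ℂ) : ℂ :=
  1 + 2 * ∑' n : ℕ, exp (piC * I * τ * ((n : ℂ) + 1) ^ 2) * cos (2 * ((n : ℂ) + 1) * z)

/-- Jacobi theta function θ₄(z|τ). -/
def theta4 (z τ : ℂ) : ℂ :=
  1 + 2 * ∑' n : ℕ, (-1 : ℂ) ^ (n + 1) * exp (piC * I * τ * ((n : ℂ) + 1) ^ 2) *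
    cos (2 * ((n : ℂ) + 1) * z)

/-- θ₁'(τ) = (∂θ₁/∂z)(0|τ). -/
def theta1' (τ : ℂ) : ℂ := deriv (fun z => theta1 z τ) 0

/-- The Dedekind eta function. -/
def eta (τ : ℂ) : ℂ := exp (piC * I * τ / 12) * ∏' n : ℕ, (1 - qq τ ^ (n + 1))

/-- Eisenstein series L = E₂. -/
def EisL (τ : ℂ) : ℂ :=
  1 - 24 * ∑' n : ℕ, ((n : ℂ) + 1) * qq τ ^ (n + 1) / (1 - qq τ ^ (n + 1))

/-- Eisenstein series M = E₄. -/
def EisM (τ : ℂ) : ℂ :=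
  1 + 240 * ∑' n : ℕ, ((n : ℂ) + 1) ^ 3 * qq τ ^ (n + 1) / (1 - qq τ ^ (n + 1))

/-- The period lattice Λ = {mπ + nπτ : m, n ∈ ℤ}. -/
def Lambda (τ : ℂ) : Set ℂ := {z | ∃ m n : ℤ, z = (m : ℂ) * piC + (n : ℂ) * piC * τ}

/-- The Weierstrass ℘ function attached to the lattice with periods π and πτ. -/
def wp (τ z : ℂ) : ℂ :=
  1 / z ^ 2 + ∑' p : ℤ × ℤ,
    if p = (0, 0) then 0
    else 1 / (z - ((p.1 : ℂ) * piC + (p.2 : ℂ) * piC * τ)) ^ 2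
      - 1 / ((p.1 : ℂ) * piC + (p.2 : ℂ) * piC * τ) ^ 2

/-- A continuous periodic function on the line all of whose Fourier coefficients vanish is zero. -/
lemma eq_zero_of_periodic_of_fourier_integral_eq_zero {T : ℝ} (hT : 0 < T) {g : ℝ → ℂ}
    (hg : Continuous g) (hper : Function.Periodic g T)
    (h0 : ∀ n : ℤ, ∫ t in (0 : ℝ)..T, exp (-(2 * Real.pi * I * n * t / T)) * g t = 0) (t : ℝ) :
    g t = 0 := by
  have : Fact (0 < T) := ⟨hT⟩
  let f : C(AddCircle T, ℂ) := ⟨hper.lift, hg.quotient_liftOn' _⟩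
  have hc : ∀ n : ℤ, fourierCoeff f n = 0 := by
    intro n
    rw [fourierCoeff_eq_intervalIntegral f n 0, zero_add]
    have : ∫ x in (0 : ℝ)..T, fourier (-n) (x : AddCircle T) • f x = 0 := by
      rw [← h0 n]
      refine intervalIntegral.integral_congr fun x _ => ?_
      simp only [fourier_coe_apply, smul_eq_mul]
      congr 2
      push_cast
      ring
    rw [this, smul_zero]
  have hs := has_pointwise_sum_fourier_series_of_summable (f := f)
    (by simp only [funext hc]; exact summable_zero) (t : AddCircle T)
  simp only [hc, zero_smul] at hs
  exact hs.unique hasSum_zero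

/-- The integral of an entire periodic function over a period does not depend on the starting
point, even a complex one. -/
lemma integral_add_eq_of_periodic {h : ℂ → ℂ} (hh : Differentiable ℂ h) {T : ℝ}
    (hper : Function.Periodic h (T : ℂ)) (w : ℂ) :
    ∫ t in (0 : ℝ)..T, h (t + w) = ∫ t in (0 : ℝ)..T, h t := by
  obtain ⟨P, hP⟩ := hh.isExactOn_univ
  have hP' : ∀ z, HasDerivAt P (h z) z := fun z => hP z trivial
  have key : ∀ w : ℂ, ∫ t in (0 : ℝ)..T, h (t + w) = P (T + w) - P (0 + w) := by
    intro w
    have := intervalIntegral.integral_eq_sub_of_hasDerivAt (a := 0) (b := T)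
      (f := fun t : ℝ => P (t + w)) (f' := fun t : ℝ => h (t + w))
      (fun t _ => by
        have h1 : HasDerivAt (fun z : ℂ => P (z + w)) (h (t + w)) t :=
          HasDerivAt.comp_add_const (t : ℂ) w (hP' _)
        exact h1.comp_ofReal)
      ((hh.continuous.comp (by fun_prop)).intervalIntegrable _ _)
    simpa using this
  have hconst : ∀ w : ℂ, P (T + w) - P (0 + w) = P (T + 0) - P (0 + 0) := by
    have hd : ∀ w : ℂ, HasDerivAt (fun w => P (T + w) - P (0 + w)) 0 w := by
      intro w
      have h1 := (HasDerivAt.comp_const_add (T : ℂ) w (hP' _)).sub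
        (HasDerivAt.comp_const_add (0 : ℂ) w (hP' _))
      have h2 : h (T + w) - h (0 + w) = 0 := by
        rw [add_comm, hper w, zero_add, sub_self]
      rw [h2] at h1
      exact h1
    intro w
    exact is_const_of_deriv_eq_zero (fun w => (hd w).differentiableAt) (fun w => (hd w).deriv) w 0
  rw [key w, hconst w, ← key 0]
  simp

/-- The space of odd entire functions with the quasi-periodicity of a product of three theta
functions. -/
def oddCubicTheta (τ : ℂ) : Submodule ℂ (ℂ → ℂ) where
  carrier := {f | Differentiable ℂ f ∧ (∀ z, f (-z) = -f z) ∧ (∀ z, f z = -f (z + piC)) ∧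
    ∀ z, f z = -exp (3 * piC * I * τ) * exp (6 * I * z) * f (z + piC * τ)}
  zero_mem' := ⟨differentiable_const 0, by simp, by simp, by simp⟩
  add_mem' := by
    rintro f g ⟨f1, f2, f3, f4⟩ ⟨g1, g2, g3, g4⟩
    refine ⟨f1.add g1, fun z => ?_, fun z => ?_, fun z => ?_⟩
    · simp only [Pi.add_apply, f2 z, g2 z]; ring
    · simp only [Pi.add_apply]; rw [f3 z, g3 z]; ring
    · simp only [Pi.add_apply]; rw [f4 z, g4 z]; ring
  smul_mem' := by
    rintro c f ⟨f1, f2, f3, f4⟩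
    refine ⟨f1.const_smul c, fun z => ?_, fun z => ?_, fun z => ?_⟩
    · simp only [Pi.smul_apply, smul_eq_mul, f2 z]; ring
    · simp only [Pi.smul_apply, smul_eq_mul]; rw [f3 z]; ring
    · simp only [Pi.smul_apply, smul_eq_mul]; rw [f4 z]; ring

/-- The Fourier coefficient of `exp ((2 * n + 1) * I * z)` in a `π`-antiperiodic function, up to
the factor `π`. -/
def oddFourierCoeff (f : ℂ → ℂ) (n : ℤ) : ℂ :=
  ∫ t in (0 : ℝ)..Real.pi, exp (-((2 * (n : ℂ) + 1) * I * t)) * f t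

lemma exp_mul_periodic {f : ℂ → ℂ} (hf : ∀ z, f z = -f (z + piC)) (n : ℤ) :
    Function.Periodic (fun z : ℂ => exp (-((2 * (n : ℂ) + 1) * I * z)) * f z)
      (Real.pi : ℂ) := by
  intro z
  have h1 : exp (-((2 * (n : ℂ) + 1) * I * (z + Real.pi))) =
      -exp (-((2 * (n : ℂ) + 1) * I * z)) := by
    have : -((2 * (n : ℂ) + 1) * I * (z + Real.pi)) =
        -((2 * (n : ℂ) + 1) * I * z) + ((-n : ℤ) : ℂ) * (2 * Real.pi * I) - Real.pi * I := by
      push_cast; ring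
    rw [this, Complex.exp_sub, Complex.exp_add, exp_int_mul_two_pi_mul_I, exp_pi_mul_I]
    ring
  have h2 := hf z
  simp only [piC] at h2
  simp only [h1]
  rw [h2]
  ring

lemma integral_add_eq_oddFourierCoeff {f : ℂ → ℂ} (hd : Differentiable ℂ f)
    (hf : ∀ z, f z = -f (z + piC)) (n : ℤ) (w : ℂ) :
    ∫ t in (0 : ℝ)..Real.pi, exp (-((2 * (n : ℂ) + 1) * I * (t + w))) * f (t + w) =
      oddFourierCoeff f n :=
  integral_add_eq_of_periodic
    (h := fun z : ℂ => exp (-((2 * (n : ℂ) + 1) * I * z)) * f z)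
    (by fun_prop) (exp_mul_periodic hf n) w

/-- An antiperiodic entire function with vanishing Fourier coefficients is zero. -/
lemma eq_zero_of_oddFourierCoeff_eq_zero {f : ℂ → ℂ} (hd : Differentiable ℂ f)
    (hf : ∀ z, f z = -f (z + piC)) (h0 : ∀ n, oddFourierCoeff f n = 0) : f = 0 := by
  funext w
  have hper := exp_mul_periodic hf 0
  have := eq_zero_of_periodic_of_fourier_integral_eq_zero Real.pi_pos
    (g := fun t : ℝ => exp (-((2 * ((0 : ℤ) : ℂ) + 1) * I * (t + w))) * f (t + w))
    (by have := hd.continuous; fun_prop)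
    (fun t => by
      have := hper (t + w)
      simp only at this ⊢
      rw [← this]
      push_cast
      ring_nf)
    (fun n => by
      have h1 := integral_add_eq_oddFourierCoeff hd hf n w
      rw [h0 n] at h1
      have h2 : ∀ t : ℝ, exp (-(2 * Real.pi * I * n * t / Real.pi)) *
          (exp (-((2 * ((0 : ℤ) : ℂ) + 1) * I * (t + w))) * f (t + w)) =
          exp (2 * n * I * w) *
            (exp (-((2 * (n : ℂ) + 1) * I * (t + w))) * f (t + w)) := by
        intro t
        have hpi : (Real.pi : ℂ) ≠ 0 := ofReal_ne_zero.mpr Real.pi_ne_zero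
        rw [← mul_assoc, ← mul_assoc, ← Complex.exp_add, ← Complex.exp_add]
        congr 2
        field_simp
        push_cast
        ring
      simp only [h2]
      rw [intervalIntegral.integral_const_mul, h1, mul_zero]) 0
  simpa using this

lemma oddFourierCoeff_eq_mul_add_three {τ : ℂ} {f : ℂ → ℂ} (hf : f ∈ oddCubicTheta τ) (n : ℤ) :
    oddFourierCoeff f n = -exp (-((2 * n + 4) * I * (piC * τ))) * oddFourierCoeff f (n + 3) := by
  obtain ⟨hd, -, h1, h2⟩ := hf
  rw [← integral_add_eq_oddFourierCoeff hd h1 n (piC * τ)]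
  unfold oddFourierCoeff
  rw [← intervalIntegral.integral_const_mul]
  refine intervalIntegral.integral_congr fun t _ => ?_
  rw [h2 t]
  have : exp (-((2 * (n : ℂ) + 1) * I * (t + piC * τ))) =
      exp (-((2 * n + 4) * I * (piC * τ))) *
        exp (-((2 * ((n + 3 : ℤ) : ℂ) + 1) * I * t)) *
        (exp (3 * piC * I * τ) * exp (6 * I * t)) := by
    rw [← Complex.exp_add, ← Complex.exp_add, ← Complex.exp_add]
    congr 1
    push_cast
    ring
  rw [this]
  ring

lemma oddFourierCoeff_reflect {τ : ℂ} {f : ℂ → ℂ} (hf : f ∈ oddCubicTheta τ) (n : ℤ) :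
    oddFourierCoeff f (-1 - n) = -oddFourierCoeff f n := by
  obtain ⟨hd, ho, h1, -⟩ := hf
  rw [← integral_add_eq_oddFourierCoeff hd h1 n (-Real.pi)]
  unfold oddFourierCoeff
  rw [← intervalIntegral.integral_neg]
  have := intervalIntegral.integral_comp_sub_left (a := 0) (b := Real.pi)
    (fun t : ℝ => exp (-((2 * ((-1 - n : ℤ) : ℂ) + 1) * I * t)) * f t) Real.pi
  rw [sub_self, sub_zero] at this
  rw [← this]
  refine intervalIntegral.integral_congr fun t _ => ?_
  have e : ((Real.pi - t : ℝ) : ℂ) = -(t + -Real.pi) := by push_cast; ring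
  rw [e, ho]
  push_cast
  ring_nf

/-- An element of `oddCubicTheta τ` is determined by two of its Fourier coefficients. -/
lemma eq_zero_of_mem_oddCubicTheta {τ : ℂ} {f : ℂ → ℂ} (hf : f ∈ oddCubicTheta τ)
    (h0 : oddFourierCoeff f 0 = 0) (h1 : oddFourierCoeff f 1 = 0) : f = 0 := by
  have hm : oddFourierCoeff f (-1) = 0 := by
    simpa [h0] using oddFourierCoeff_reflect hf 0
  have hstep : ∀ n : ℤ, oddFourierCoeff f n = 0 ↔ oddFourierCoeff f (n + 3) = 0 := by
    intro n
    rw [oddFourierCoeff_eq_mul_add_three hf n]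
    simp [Complex.exp_ne_zero]
  have hall : ∀ m : ℤ, oddFourierCoeff f (3 * m - 1) = 0 ∧ oddFourierCoeff f (3 * m) = 0 ∧
      oddFourierCoeff f (3 * m + 1) = 0 := by
    intro m
    induction m using Int.induction_on with
    | zero => simp [h0, h1, hm]
    | succ k ih =>
      obtain ⟨a, b, c⟩ := ih
      rw [hstep] at a b c
      refine ⟨?_, ?_, ?_⟩
      · convert a using 2; ring
      · convert b using 2; ring
      · convert c using 2; ring
    | pred k ih =>
      obtain ⟨a, b, c⟩ := ih
      refine ⟨?_, ?_, ?_⟩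
      · rw [hstep]; convert a using 2; ring
      · rw [hstep]; convert b using 2; ring
      · rw [hstep]; convert c using 2; ring
  refine eq_zero_of_oddFourierCoeff_eq_zero hf.1 hf.2.2.1 fun n => ?_
  obtain ⟨m, hm | hm | hm⟩ : ∃ m : ℤ, n = 3 * m - 1 ∨ n = 3 * m ∨ n = 3 * m + 1 :=
    ⟨(n + 1) / 3, by omega⟩
  · exact hm ▸ (hall m).1
  · exact hm ▸ (hall m).2.1
  · exact hm ▸ (hall m).2.2

lemma oddFourierCoeff_add {f g : ℂ → ℂ} (hf : Continuous f) (hg : Continuous g) (n : ℤ) :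
    oddFourierCoeff (f + g) n = oddFourierCoeff f n + oddFourierCoeff g n := by
  unfold oddFourierCoeff
  rw [← intervalIntegral.integral_add]
  · simp [mul_add]
  · exact Continuous.intervalIntegrable (by fun_prop) _ _
  · exact Continuous.intervalIntegrable (by fun_prop) _ _

lemma oddFourierCoeff_smul (c : ℂ) (f : ℂ → ℂ) (n : ℤ) :
    oddFourierCoeff (c • f) n = c * oddFourierCoeff f n := by
  unfold oddFourierCoeff
  rw [← intervalIntegral.integral_const_mul]
  simp [mul_left_comm]

/-- If evaluation at `a` and `b` separates two elements of `oddCubicTheta τ` diagonally, then an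
element vanishing at both points is zero. -/
lemma eq_zero_of_apply_eq_zero {τ : ℂ} {f g h : ℂ → ℂ} (hf : f ∈ oddCubicTheta τ)
    (hg : g ∈ oddCubicTheta τ) (hh : h ∈ oddCubicTheta τ) {a b : ℂ} (hga : g a ≠ 0)
    (hgb : g b = 0) (hha : h a = 0) (hhb : h b ≠ 0) (hfa : f a = 0) (hfb : f b = 0) :
    f = 0 := by
  have comb : ∀ r s t : ℂ, ∀ n : ℤ, oddFourierCoeff (r • f + (s • g + t • h)) n =
      r * oddFourierCoeff f n + (s * oddFourierCoeff g n + t * oddFourierCoeff h n) := by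
    intro r s t n
    have cf := hf.1.continuous
    have cg := hg.1.continuous
    have ch := hh.1.continuous
    rw [oddFourierCoeff_add (cf.const_smul r) ((cg.const_smul s).add (ch.const_smul t)),
      oddFourierCoeff_add (cg.const_smul s) (ch.const_smul t)]
    simp only [oddFourierCoeff_smul]
  have indep : ∀ r s t : ℂ,
      (∀ n : ℤ, n = 0 ∨ n = 1 → r * oddFourierCoeff f n +
        (s * oddFourierCoeff g n + t * oddFourierCoeff h n) = 0) →
      s = 0 ∧ t = 0 ∧ (r = 0 ∨ f = 0) := by
    intro r s t hn
    have hz : r • f + (s • g + t • h) = 0 := by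
      refine eq_zero_of_mem_oddCubicTheta (τ := τ)
        (add_mem (Submodule.smul_mem _ _ hf)
          (add_mem (Submodule.smul_mem _ _ hg) (Submodule.smul_mem _ _ hh))) ?_ ?_
      · rw [comb]; exact hn 0 (Or.inl rfl)
      · rw [comb]; exact hn 1 (Or.inr rfl)
    have ha := congrFun hz a
    have hb := congrFun hz b
    simp [hfa, hha, hga] at ha
    simp [hfb, hgb, hhb] at hb
    subst ha hb
    simp only [zero_smul, add_zero] at hz
    exact ⟨rfl, rfl, smul_eq_zero.mp hz⟩
  set g0 := oddFourierCoeff g 0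
  set g1 := oddFourierCoeff g 1
  set h0 := oddFourierCoeff h 0
  set h1 := oddFourierCoeff h 1
  set f0 := oddFourierCoeff f 0
  set f1 := oddFourierCoeff f 1
  obtain ⟨-, -, hD | h⟩ := indep (g0 * h1 - g1 * h0) (h0 * f1 - h1 * f0) (f0 * g1 - f1 * g0) (by
    rintro n (rfl | rfl) <;> ring)
  · obtain ⟨e1, e2, -⟩ := indep 0 h0 (-g0) (by
      rintro n (rfl | rfl)
      · ring
      · linear_combination -hD)
    obtain ⟨e3, e4, -⟩ := indep 0 h1 (-g1) (by
      rintro n (rfl | rfl)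
      · linear_combination hD
      · ring)
    obtain ⟨e5, -⟩ := indep 0 1 0 (by
      rintro n (rfl | rfl)
      · linear_combination -e2
      · linear_combination -e4)
    exact absurd e5 one_ne_zero
  · exact h

lemma exists_jacobiTheta₂_ne_zero {τ : ℂ} (hτ : 0 < τ.im) : ∃ z, jacobiTheta₂ z τ ≠ 0 := by
  by_contra! hcon
  have hs : HasSum (fun n : ℤ => ∫ t in (0 : ℝ)..1, jacobiTheta₂_term n t τ)
      (∫ t in (0 : ℝ)..1, jacobiTheta₂ t τ) := by
    refine intervalIntegral.hasSum_integral_of_dominated_convergence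
      (fun n _ => ‖jacobiTheta₂_term n 0 τ‖) (fun n => ?_) (fun n => ?_) ?_ ?_ ?_
    · refine Continuous.aestronglyMeasurable ?_
      unfold jacobiTheta₂_term
      fun_prop
    · refine Filter.Eventually.of_forall fun t _ => le_of_eq ?_
      simp [norm_jacobiTheta₂_term]
    · exact Filter.Eventually.of_forall fun t _ =>
        ((summable_jacobiTheta₂_term_iff 0 τ).mpr hτ).norm
    · exact intervalIntegrable_const
    · exact Filter.Eventually.of_forall fun t _ => hasSum_jacobiTheta₂_term t hτ
  have hterm : ∀ n : ℤ, n ≠ 0 → ∫ t in (0 : ℝ)..1, jacobiTheta₂_term n t τ = 0 := by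
    intro n hn
    have hc : 2 * Real.pi * I * (n : ℂ) ≠ 0 := by
      simp [hn, Real.pi_ne_zero]
    simp only [jacobiTheta₂_term, Complex.exp_add]
    rw [intervalIntegral.integral_mul_const, integral_exp_mul_complex hc]
    have : 2 * Real.pi * I * (n : ℂ) * ((1 : ℝ) : ℂ) = n * (2 * Real.pi * I) := by
      push_cast; ring
    rw [this, exp_int_mul_two_pi_mul_I]
    simp
  have h1 := hs.unique (hasSum_single 0 hterm)
  simp [hcon, jacobiTheta₂_term] at h1

lemma theta1_eq_jacobiTheta₂ (z τ : ℂ) :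
    theta1 z τ = -I * exp (piC * I * τ / 4) * exp (I * z) *
      jacobiTheta₂ (z / piC + τ / 2 + 1 / 2) τ := by
  have hpi : (Real.pi : ℂ) ≠ 0 := ofReal_ne_zero.mpr Real.pi_ne_zero
  unfold theta1 jacobiTheta₂
  rw [mul_assoc (-I * exp (piC * I * τ / 4)), ← tsum_mul_left (a := exp (I * z))]
  congr 1
  refine tsum_congr fun n => ?_
  have hsign : (-1 : ℂ) ^ n = exp (n * (Real.pi * I)) := by
    rw [Complex.exp_int_mul, exp_pi_mul_I]
  rw [hsign, jacobiTheta₂_term, ← Complex.exp_add, ← Complex.exp_add, ← Complex.exp_add]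
  congr 1
  unfold piC
  field_simp
  ring

lemma differentiable_theta1 {τ : ℂ} (hτ : 0 < τ.im) : Differentiable ℂ (fun z => theta1 z τ) := by
  simp only [theta1_eq_jacobiTheta₂]
  have h : Differentiable ℂ (fun z => jacobiTheta₂ z τ) :=
    fun z => differentiableAt_jacobiTheta₂_fst z hτ
  have h2 : Differentiable ℂ (fun z => jacobiTheta₂ (z / piC + τ / 2 + 1 / 2) τ) :=
    h.comp (g := fun z => jacobiTheta₂ z τ) (f := fun z => z / piC + τ / 2 + 1 / 2) (by fun_prop)
  fun_prop

lemma piC_ne_zero : piC ≠ 0 := ofReal_ne_zero.mpr Real.pi_ne_zero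

lemma theta1_add_pi (z τ : ℂ) : theta1 (z + piC) τ = -theta1 z τ := by
  rw [theta1_eq_jacobiTheta₂, theta1_eq_jacobiTheta₂]
  have h1 : (z + piC) / piC + τ / 2 + 1 / 2 = (z / piC + τ / 2 + 1 / 2) + 1 := by
    field_simp [piC_ne_zero]
    ring
  have h2 : exp (I * (z + piC)) = -exp (I * z) := by
    rw [mul_add, Complex.exp_add, mul_comm I piC, piC, exp_pi_mul_I]
    ring
  rw [h1, h2, jacobiTheta₂_add_left]
  ring

lemma theta1_eq_mul_theta1_add (z τ : ℂ) :
    theta1 z τ = -exp (piC * I * τ) * exp (2 * I * z) * theta1 (z + piC * τ) τ := by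
  rw [theta1_eq_jacobiTheta₂, theta1_eq_jacobiTheta₂]
  have h1 : (z + piC * τ) / piC + τ / 2 + 1 / 2 = (z / piC + τ / 2 + 1 / 2) + τ := by
    field_simp [piC_ne_zero]
    ring
  have h2 : exp (piC * I * τ) * exp (2 * I * z) * exp (I * (z + piC * τ)) *
      exp (-Real.pi * I * (τ + 2 * (z / piC + τ / 2 + 1 / 2))) = -exp (I * z) := by
    rw [← Complex.exp_add, ← Complex.exp_add, ← Complex.exp_add]
    have : piC * I * τ + 2 * I * z + I * (z + piC * τ) +
        -Real.pi * I * (τ + 2 * (z / piC + τ / 2 + 1 / 2)) = I * z - Real.pi * I := by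
      have := piC_ne_zero
      change _ + -piC * I * _ = I * z - piC * I
      field_simp
      ring
    rw [this, Complex.exp_sub, exp_pi_mul_I]
    ring
  rw [h1, jacobiTheta₂_add_left']
  linear_combination (-I * exp (piC * I * τ / 4) *
    jacobiTheta₂ (z / piC + τ / 2 + 1 / 2) τ) * h2

lemma theta1_neg (z τ : ℂ) : theta1 (-z) τ = -theta1 z τ := by
  rw [theta1_eq_jacobiTheta₂, theta1_eq_jacobiTheta₂]
  have h1 : -z / piC + τ / 2 + 1 / 2 = -(z / piC - τ / 2 - 1 / 2) := by ring
  have h2 : z / piC + τ / 2 + 1 / 2 = ((z / piC - τ / 2 - 1 / 2) + τ) + 1 := by ring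
  have h3 : exp (I * z) * exp (-Real.pi * I * (τ + 2 * (z / piC - τ / 2 - 1 / 2))) =
      -exp (I * -z) := by
    rw [← Complex.exp_add]
    have : I * z + -Real.pi * I * (τ + 2 * (z / piC - τ / 2 - 1 / 2)) =
        I * -z + Real.pi * I := by
      have := piC_ne_zero
      change _ + -piC * I * _ = _ + piC * I
      field_simp
      ring
    rw [this, Complex.exp_add, exp_pi_mul_I]
    ring
  rw [h1, h2, jacobiTheta₂_neg_left, jacobiTheta₂_add_left, jacobiTheta₂_add_left']
  linear_combination (-I * exp (piC * I * τ / 4) *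
    jacobiTheta₂ (z / piC - τ / 2 - 1 / 2) τ) * h3

lemma exists_theta1_ne_zero {τ : ℂ} (hτ : 0 < τ.im) : ∃ z, theta1 z τ ≠ 0 := by
  obtain ⟨w, hw⟩ := exists_jacobiTheta₂_ne_zero hτ
  refine ⟨piC * (w - τ / 2 - 1 / 2), ?_⟩
  have : piC * (w - τ / 2 - 1 / 2) / piC + τ / 2 + 1 / 2 = w := by
    field_simp [piC_ne_zero]
    ring
  rw [theta1_eq_jacobiTheta₂, this]
  simp [hw, Complex.exp_ne_zero]

/-- The product `θ₁(x - y) θ₁(x + y) θ₁(x) θ₁(y)`. -/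
def thetaProd (τ x y : ℂ) : ℂ :=
  theta1 (x - y) τ * theta1 (x + y) τ * theta1 x τ * theta1 y τ

lemma thetaProd_swap (τ x y : ℂ) : thetaProd τ y x = -thetaProd τ x y := by
  unfold thetaProd
  rw [← neg_sub x y, theta1_neg, add_comm y x]
  ring

lemma thetaProd_mem {τ : ℂ} (hτ : 0 < τ.im) (y : ℂ) :
    (fun x => thetaProd τ x y) ∈ oddCubicTheta τ := by
  refine ⟨?_, fun x => ?_, fun x => ?_, fun x => ?_⟩
  · have h := differentiable_theta1 hτ
    have h1 : Differentiable ℂ (fun x => theta1 (x - y) τ) :=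
      h.comp (g := fun x => theta1 x τ) (f := fun x => x - y) (by fun_prop)
    have h2 : Differentiable ℂ (fun x => theta1 (x + y) τ) :=
      h.comp (g := fun x => theta1 x τ) (f := fun x => x + y) (by fun_prop)
    unfold thetaProd
    fun_prop
  · have h1 : -x - y = -(x + y) := by ring
    have h2 : -x + y = -(x - y) := by ring
    simp only [thetaProd, h1, h2, theta1_neg]
    ring
  · have h1 : x + piC - y = (x - y) + piC := by ring
    have h2 : x + piC + y = (x + y) + piC := by ring
    simp only [thetaProd, h1, h2, theta1_add_pi]
    ring
  · have h1 : x + piC * τ - y = (x - y) + piC * τ := by ring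
    have h2 : x + piC * τ + y = (x + y) + piC * τ := by ring
    simp only [thetaProd, h1, h2]
    rw [theta1_eq_mul_theta1_add (x - y), theta1_eq_mul_theta1_add (x + y),
      theta1_eq_mul_theta1_add x]
    have e : exp (piC * I * τ) * exp (2 * I * (x - y)) *
        (exp (piC * I * τ) * exp (2 * I * (x + y))) * (exp (piC * I * τ) * exp (2 * I * x)) =
        exp (3 * piC * I * τ) * exp (6 * I * x) := by
      simp only [← Complex.exp_add]
      congr 1
      ring
    linear_combination (-theta1 (x - y + piC * τ) τ * theta1 (x + y + piC * τ) τ *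
      theta1 (x + piC * τ) τ * theta1 y τ) * e

lemma exists_thetaProd_ne_zero {τ : ℂ} (hτ : 0 < τ.im) : ∃ x y, thetaProd τ x y ≠ 0 := by
  obtain ⟨w, hw⟩ := exists_theta1_ne_zero hτ
  have hd := differentiable_theta1 hτ
  have key : ∀ c : ℂ, ∀ᶠ x in nhdsWithin 0 {0}ᶜ, theta1 (x + c) τ ≠ 0 := by
    intro c
    have hc : Differentiable ℂ (fun x => theta1 (x + c) τ) :=
      hd.comp (g := fun x => theta1 x τ) (f := fun x => x + c) (by fun_prop)
    have ha : AnalyticOnNhd ℂ (fun x => theta1 (x + c) τ) Set.univ := fun x _ => hc.analyticAt x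
    by_contra hcon
    have hz := ha.eqOn_zero_of_preconnected_of_frequently_eq_zero isPreconnected_univ
      (Set.mem_univ 0) (by simpa using hcon) (Set.mem_univ (w - c))
    simp only [sub_add_cancel] at hz
    exact hw hz
  obtain ⟨x, h1, h2, h3⟩ := ((key (-w)).and ((key w).and (key 0))).exists
  refine ⟨x, w, ?_⟩
  rw [add_zero] at h3
  simp [thetaProd, sub_eq_add_neg, h1, h2, h3, hw]

theorem statement5 (τ : ℂ) (hτ : 0 < τ.im) (F G : ℂ → ℂ)
    (hF : Differentiable ℂ F) (hG : Differentiable ℂ G)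
    (hFodd : ∀ z : ℂ, F (-z) = -F z) (hGodd : ∀ z : ℂ, G (-z) = -G z)
    (hF1 : ∀ z : ℂ, F z = -F (z + piC))
    (hF2 : ∀ z : ℂ, F z = -exp (3 * piC * I * τ) * exp (6 * I * z) * F (z + piC * τ))
    (hG1 : ∀ z : ℂ, G z = -G (z + piC))
    (hG2 : ∀ z : ℂ, G z = -exp (3 * piC * I * τ) * exp (6 * I * z) * G (z + piC * τ)) :
    ∃ C : ℂ, ∀ x y : ℂ,
      F x * G y - F y * G x =
        C * theta1 (x - y) τ * theta1 (x + y) τ * theta1 x τ * theta1 y τ := by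
  have hFm : F ∈ oddCubicTheta τ := ⟨hF, hFodd, hF1, hF2⟩
  have hGm : G ∈ oddCubicTheta τ := ⟨hG, hGodd, hG1, hG2⟩
  obtain ⟨a, b, hab⟩ := exists_thetaProd_ne_zero hτ
  have diag : ∀ x, thetaProd τ x x = 0 := fun x => by
    have := thetaProd_swap τ x x
    linear_combination (1 / 2) * this
  set C := (F a * G b - F b * G a) / thetaProd τ a b with hC
  let D : ℂ → ℂ → ℂ := fun x y => F x * G y - F y * G x - C * thetaProd τ x y
  have hCab : C * thetaProd τ a b = F a * G b - F b * G a := div_mul_cancel₀ _ hab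
  have D_swap : ∀ x y, D y x = -D x y := fun x y => by
    simp only [D, thetaProd_swap τ x y]
    ring
  have D_diag : ∀ x, D x x = 0 := fun x => by
    simp only [D, diag]
    ring
  have D_ab : D a b = 0 := by
    simp only [D, hCab, sub_self]
  have D_mem : ∀ y, (fun x => D x y) ∈ oddCubicTheta τ := by
    intro y
    have : (fun x => D x y) = G y • F - F y • G - C • (fun x => thetaProd τ x y) := by
      funext x
      simp only [D, Pi.sub_apply, Pi.smul_apply, smul_eq_mul]
      ring
    rw [this]
    exact sub_mem (sub_mem (Submodule.smul_mem _ _ hFm) (Submodule.smul_mem _ _ hGm))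
      (Submodule.smul_mem _ _ (thetaProd_mem hτ y))
  have D_zero : ∀ y, D a y = 0 → D b y = 0 → ∀ x, D x y = 0 := fun y hay hby =>
    congrFun (eq_zero_of_apply_eq_zero (D_mem y) (thetaProd_mem hτ b) (thetaProd_mem hτ a)
      hab (diag b) (diag a) (by simpa [thetaProd_swap τ a b] using hab) hay hby)
  have Da : ∀ x, D x a = 0 := D_zero a (D_diag a) (by rw [D_swap a b, D_ab, neg_zero])
  have Db : ∀ x, D x b = 0 := D_zero b D_ab (D_diag b)
  refine ⟨C, fun x y => ?_⟩
  have hD : D x y = 0 :=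
    D_zero y (by rw [D_swap y a, Da, neg_zero]) (by rw [D_swap y b, Db, neg_zero]) x
  simp only [D, thetaProd] at hD
  linear_combination hD
end Liu
end
end

section
/- Let m > 1 be a square-free integer with m ≡ 1 (mod 4). Then (∏_{n=1}^∞ (1−qⁿ)) · ∑_{k=1}^{(m−1)/2} (k/m) · θ₁(4kπ/m | τ)/θ₁(2kπ/m | τ) = √m · ∑_{n∈ℤ} (−1)ⁿ ((6n+1)/m) q^{n(3n+1)/2}, where (a/m) denotes the Jacobi symbol modulo m. -/
noncomputable section

open Complex

namespace Liu

/-- The Gaussian binomial coefficient, given by its `q`-Pascal recursion. -/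
def gaussBinom (q : ℂ) : ℕ → ℕ → ℂ
  | 0, 0 => 1
  | 0, _ + 1 => 0
  | M + 1, 0 => gaussBinom q M 0
  | M + 1, k + 1 => q ^ (k + 1) * gaussBinom q M (k + 1) + gaussBinom q M k

/-- The finite `q`-factorial product `(1 - q) ⋯ (1 - q ^ n)`. -/
def qFac (q : ℂ) (n : ℕ) : ℂ := ∏ j ∈ Finset.range n, (1 - q ^ (j + 1))

lemma gaussBinom_zero_right (q : ℂ) (M : ℕ) : gaussBinom q M 0 = 1 := by
  induction M with
  | zero => rfl
  | succ M ih => simpa [gaussBinom] using ih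

lemma gaussBinom_of_lt (q : ℂ) {M k : ℕ} (h : M < k) : gaussBinom q M k = 0 := by
  induction M generalizing k with
  | zero => obtain ⟨k, rfl⟩ := Nat.exists_eq_add_of_lt h; simp [gaussBinom]
  | succ M ih =>
    obtain ⟨k, rfl⟩ : ∃ j, k = j + 1 := ⟨k - 1, by omega⟩
    simp [gaussBinom, ih (show M < k + 1 by omega), ih (show M < k by omega)]

lemma gaussBinom_mul_qFac (q : ℂ) (a b : ℕ) :
    gaussBinom q (a + b) a * (qFac q a * qFac q b) = qFac q (a + b) := by
  induction h : a + b generalizing a b with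
  | zero =>
    obtain ⟨rfl, rfl⟩ : a = 0 ∧ b = 0 := by omega
    simp [gaussBinom, qFac]
  | succ M ih =>
    cases a with
    | zero =>
      obtain rfl : b = M + 1 := by omega
      rw [gaussBinom_zero_right]; simp [qFac]
    | succ a =>
      have hs (n : ℕ) : qFac q (n + 1) = qFac q n * (1 - q ^ (n + 1)) := by
        simp [qFac, Finset.prod_range_succ]
      cases b with
      | zero =>
        have h1 := ih a 0 (by omega)
        obtain rfl : a = M := by omega
        rw [gaussBinom, gaussBinom_of_lt q (Nat.lt_succ_self a), hs]
        linear_combination (1 - q ^ (a + 1)) * h1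
      | succ b =>
        have h1 := ih a (b + 1) (by omega)
        have h2 := ih (a + 1) b (by omega)
        rw [gaussBinom, hs M]
        obtain rfl : M = a + b + 1 := by omega
        rw [hs a] at *
        rw [hs b] at *
        linear_combination (1 - q ^ (a + 1)) * h1 + q ^ (a + 1) * (1 - q ^ (b + 1)) * h2

/-- The finite `q`-binomial theorem. -/
lemma prod_one_add_eq_sum_gaussBinom (q y : ℂ) (M : ℕ) :
    ∏ j ∈ Finset.range M, (1 + y * q ^ j) =
      ∑ k ∈ Finset.range (M + 1), q ^ (k.choose 2) * y ^ k * gaussBinom q M k := by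
  induction M generalizing y with
  | zero => simp [gaussBinom]
  | succ M ih =>
    have h1 : ∏ j ∈ Finset.range (M + 1), (1 + y * q ^ j) =
        (1 + y) * ∏ j ∈ Finset.range M, (1 + (y * q) * q ^ j) := by
      rw [Finset.prod_range_succ', mul_comm]
      simp [pow_succ', mul_assoc]
    rw [h1, ih, Finset.sum_range_succ' _ (M + 1)]
    simp only [gaussBinom]
    have h2 : ∑ k ∈ Finset.range (M + 1), q ^ (k.choose 2) * (y * q) ^ k * gaussBinom q M k =
        ∑ k ∈ Finset.range (M + 1),
          q ^ ((k + 1).choose 2) * (y * q) ^ (k + 1) * gaussBinom q M (k + 1) + 1 := by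
      have := Finset.sum_range_succ' (fun k ↦ q ^ (k.choose 2) * (y * q) ^ k * gaussBinom q M k)
        (M + 1)
      rw [Finset.sum_range_succ, gaussBinom_of_lt q (Nat.lt_succ_self M)] at this
      simpa [gaussBinom_zero_right] using this
    rw [add_mul, one_mul]
    nth_rewrite 1 [h2]
    rw [add_right_comm, Finset.mul_sum, ← Finset.sum_add_distrib]
    simp only [Nat.choose_zero_succ, pow_zero, gaussBinom_zero_right, mul_one]
    congr 1
    refine Finset.sum_congr rfl fun k _ ↦ ?_
    have : (k + 1).choose 2 = k.choose 2 + k := by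
      rw [Nat.choose_succ_succ' k 1]; simp [add_comm]
    rw [this]
    ring

lemma summable_norm_zpow_sq_mul_zpow {p y : ℂ} (hp0 : p ≠ 0) (hp : ‖p‖ < 1) (hy : y ≠ 0) :
    Summable fun n : ℤ ↦ ‖p ^ (n ^ 2) * y ^ n‖ := by
  have hpi : (Real.pi : ℂ) * I ≠ 0 := mul_ne_zero (by exact_mod_cast Real.pi_ne_zero) I_ne_zero
  set τ : ℂ := log p / (Real.pi * I) with hτ
  set z : ℂ := log y / (2 * (Real.pi * I)) with hz
  have hτ' : p = exp (Real.pi * I * τ) := by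
    rw [hτ, mul_div_cancel₀ _ hpi, exp_log hp0]
  have hz' : y = exp (2 * (Real.pi * I) * z) := by
    rw [hz, mul_div_cancel₀ _ (mul_ne_zero two_ne_zero hpi), exp_log hy]
  have him : 0 < τ.im := by
    rw [hτ', norm_exp, Real.exp_lt_one_iff] at hp
    simp at hp
    exact (mul_pos_iff_of_pos_left Real.pi_pos).mp hp
  have h := ((summable_jacobiTheta₂_term_iff z τ).mpr him).norm
  refine h.congr fun n ↦ ?_
  rw [hτ', hz', ← exp_int_mul, ← exp_int_mul, ← exp_add, jacobiTheta₂_term]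
  congr 2
  push_cast
  ring

lemma summable_zpow_triple {p y : ℂ} (hp0 : p ≠ 0) (hp : ‖p‖ < 1) (hy : y ≠ 0) :
    Summable fun n : ℤ ↦ ‖(-1) ^ n * p ^ (n * (n - 1)) * y ^ n‖ := by
  refine (summable_norm_zpow_sq_mul_zpow hp0 hp (div_ne_zero hy hp0)).congr fun n ↦ ?_
  rw [mul_assoc, norm_mul ((-1) ^ n), norm_zpow, norm_neg, norm_one, one_zpow, one_mul]
  congr 1
  rw [div_zpow, show n * (n - 1) = n ^ 2 - n by ring, zpow_sub₀ hp0]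
  ring

/-- The finite form of the Jacobi triple product identity. -/
lemma prod_mul_prod_eq_sum_gaussBinom {p y : ℂ} (hp0 : p ≠ 0) (hy : y ≠ 0) (N : ℕ) :
    (∏ j ∈ Finset.range N, (1 - y * (p ^ 2) ^ j)) *
      ∏ j ∈ Finset.range N, (1 - (p ^ 2) ^ (j + 1) / y) =
    ∑ n ∈ Finset.Icc (-N : ℤ) N, (-1) ^ n * p ^ (n * (n - 1)) * y ^ n *
      gaussBinom (p ^ 2) (2 * N) (N + n).toNat := by
  have hq0 : p ^ 2 ≠ 0 := pow_ne_zero 2 hp0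
  set Y : ℂ := -y * ((p ^ 2) ^ N)⁻¹ with hY
  have hprod : ∏ j ∈ Finset.range (2 * N), (1 + Y * (p ^ 2) ^ j) =
      ((-y) ^ N * p ^ (-(N * (N + 1)) : ℤ)) *
        ((∏ j ∈ Finset.range N, (1 - y * (p ^ 2) ^ j)) *
          ∏ j ∈ Finset.range N, (1 - (p ^ 2) ^ (j + 1) / y)) := by
    rw [two_mul, Finset.prod_range_add, ← Finset.prod_range_reflect]
    have h1 : ∏ j ∈ Finset.range N, (1 + Y * (p ^ 2) ^ (N + j)) =
        ∏ j ∈ Finset.range N, (1 - y * (p ^ 2) ^ j) := by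
      refine Finset.prod_congr rfl fun j _ ↦ ?_
      rw [hY, pow_add]; field_simp; ring
    have h2 : ∏ j ∈ Finset.range N, (1 + Y * (p ^ 2) ^ (N - 1 - j)) =
        ∏ j ∈ Finset.range N, ((-y * ((p ^ 2) ^ (j + 1))⁻¹) * (1 - (p ^ 2) ^ (j + 1) / y)) := by
      refine Finset.prod_congr rfl fun j hj ↦ ?_
      have hj := Finset.mem_range.mp hj
      have : (p ^ 2) ^ N = (p ^ 2) ^ (N - 1 - j) * (p ^ 2) ^ (j + 1) := by
        rw [← pow_add]; congr 1; omega
      rw [hY, this]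
      have h3 := pow_ne_zero (N - 1 - j) hq0
      have h4 := pow_ne_zero (j + 1) hq0
      generalize (p ^ 2) ^ (N - 1 - j) = u at *
      generalize (p ^ 2) ^ (j + 1) = v at *
      field_simp; ring
    have h3 : ∀ N : ℕ, ∏ j ∈ Finset.range N, (-y * ((p ^ 2) ^ (j + 1))⁻¹) =
        (-y) ^ N * p ^ (-(N * (N + 1)) : ℤ) := by
      intro N
      induction N with
      | zero => simp
      | succ N ih =>
        rw [Finset.prod_range_succ, ih]
        have : p ^ (-(((N + 1 : ℕ) : ℤ) * (((N + 1 : ℕ) : ℤ) + 1))) =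
            p ^ (-(N * (N + 1)) : ℤ) * ((p ^ 2) ^ (N + 1))⁻¹ := by
          rw [← pow_mul, ← zpow_natCast, ← zpow_neg, ← zpow_add₀ hp0]
          congr 1; push_cast; ring
        rw [this]; ring
    rw [h1, h2, Finset.prod_mul_distrib, h3]
    ring
  have hK : (-y) ^ N * p ^ (-(N * (N + 1)) : ℤ) ≠ 0 :=
    mul_ne_zero (pow_ne_zero _ (neg_ne_zero.mpr hy)) (zpow_ne_zero _ hp0)
  apply mul_left_cancel₀ hK
  rw [← hprod, prod_one_add_eq_sum_gaussBinom, Finset.mul_sum]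
  symm
  refine Finset.sum_bij' (fun n _ ↦ (N + n).toNat) (fun k _ ↦ (k : ℤ) - N) ?_ ?_ ?_ ?_ ?_
  · intro n hn; simp only [Finset.mem_Icc, Finset.mem_range] at *; omega
  · intro n hn; simp only [Finset.mem_Icc, Finset.mem_range] at *; omega
  · intro n hn; simp only [Finset.mem_Icc] at *; omega
  · intro n hn; simp only [Finset.mem_range] at *; omega
  intro n hn
  obtain ⟨k, rfl⟩ : ∃ k : ℕ, n = k - N := by
    refine ⟨(N + n).toNat, ?_⟩
    simp only [Finset.mem_Icc] at hn; omega
  rw [show ((N : ℤ) + (k - N)).toNat = k by omega, ← mul_assoc]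
  congr 1
  have h1 : (p ^ 2) ^ (k.choose 2) = p ^ ((k : ℤ) * (k - 1)) := by
    rw [← pow_mul, ← zpow_natCast]
    congr 1
    rw [Nat.choose_two_right, Nat.mul_div_cancel' (Nat.even_mul_pred_self k).two_dvd]
    cases k <;> simp
  have h2 : Y ^ k = (-y) ^ k * p ^ (-(2 * N * k) : ℤ) := by
    rw [hY, mul_pow, ← pow_mul, inv_pow, ← pow_mul, ← zpow_natCast p, ← zpow_neg]
    congr 2
  have h3 : (-1 : ℂ) ^ ((k : ℤ) - N) * y ^ ((k : ℤ) - N) = (-y) ^ ((k : ℤ) - N) := by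
    rw [← mul_zpow]; simp
  rw [h1, h2]
  have h4 : (-y) ^ k = (-y) ^ N * (-y) ^ ((k : ℤ) - N) := by
    rw [← zpow_natCast, ← zpow_natCast, ← zpow_add₀ (neg_ne_zero.mpr hy)]; simp
  have h5 : p ^ ((k : ℤ) * (k - 1)) * p ^ (-(2 * N * k) : ℤ) =
      p ^ (-(N * (N + 1)) : ℤ) * p ^ (((k : ℤ) - N) * (k - N - 1)) := by
    rw [← zpow_add₀ hp0, ← zpow_add₀ hp0]; congr 1; ring
  rw [h4]
  linear_combination (-y) ^ N * p ^ (-(N * (N + 1)) : ℤ) * p ^ (((k : ℤ) - N) * (k - N - 1)) * h3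
    - (-y) ^ N * (-y) ^ ((k : ℤ) - N) * h5

lemma multipliable_one_sub_mul_pow {q : ℂ} (hq : ‖q‖ < 1) (a : ℂ) :
    Multipliable fun j : ℕ ↦ 1 - a * q ^ j := by
  simp_rw [sub_eq_add_neg]
  refine multipliable_one_add_of_summable ?_
  simp_rw [norm_neg, norm_mul, norm_pow]
  exact (summable_geometric_of_lt_one (norm_nonneg q) hq).mul_left _

lemma tprod_one_sub_mul_pow_ne_zero {q : ℂ} (hq : ‖q‖ < 1) {a : ℂ} (ha : ∀ j : ℕ, a * q ^ j ≠ 1) :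
    ∏' j : ℕ, (1 - a * q ^ j) ≠ 0 := by
  simp_rw [sub_eq_add_neg]
  refine tprod_one_add_ne_zero_of_summable (fun j h ↦ ha j ?_) ?_
  · linear_combination -h
  simp_rw [norm_neg, norm_mul, norm_pow]
  exact (summable_geometric_of_lt_one (norm_nonneg q) hq).mul_left _

lemma mul_pow_ne_one {q : ℂ} (hq : ‖q‖ < 1) (j : ℕ) : q * q ^ j ≠ 1 := by
  intro h
  have h1 : ‖q‖ ^ (j + 1) = 1 := by rw [← norm_pow, pow_succ', h, norm_one]
  exact absurd h1 (pow_lt_one₀ (norm_nonneg q) hq j.succ_ne_zero).ne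

lemma tendsto_qFac {q : ℂ} (hq : ‖q‖ < 1) :
    Filter.Tendsto (qFac q) Filter.atTop (nhds (∏' j : ℕ, (1 - q * q ^ j))) := by
  refine (multipliable_one_sub_mul_pow hq q).hasProd.tendsto_prod_nat.congr fun n ↦ ?_
  simp [qFac, pow_succ']

lemma exists_norm_gaussBinom_le {q : ℂ} (hq : ‖q‖ < 1) :
    ∃ C : ℝ, ∀ a b : ℕ, ‖gaussBinom q (a + b) a‖ ≤ C := by
  have hE := tendsto_qFac hq
  have hne (n : ℕ) : qFac q n ≠ 0 := by
    refine Finset.prod_ne_zero_iff.mpr fun j _ h ↦ mul_pow_ne_one hq j ?_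
    rw [← pow_succ']; linear_combination -h
  obtain ⟨U, hU⟩ := hE.norm.bddAbove_range
  obtain ⟨V, hV⟩ :=
    (hE.inv₀ (tprod_one_sub_mul_pow_ne_zero hq (mul_pow_ne_one hq))).norm.bddAbove_range
  have hU' (n : ℕ) : ‖qFac q n‖ ≤ U := hU ⟨n, rfl⟩
  have hV' (n : ℕ) : ‖(qFac q n)⁻¹‖ ≤ V := hV ⟨n, rfl⟩
  refine ⟨U * (V * V), fun a b ↦ ?_⟩
  have : gaussBinom q (a + b) a = qFac q (a + b) * ((qFac q a)⁻¹ * (qFac q b)⁻¹) := by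
    rw [← gaussBinom_mul_qFac]
    field_simp [hne a, hne b]
  rw [this, norm_mul, norm_mul]
  have hU0 := (norm_nonneg _).trans (hU' 0)
  have hV0 := (norm_nonneg _).trans (hV' 0)
  gcongr
  exacts [hU' _, hV' _, hV' _]

lemma tendsto_gaussBinom {q : ℂ} (hq : ‖q‖ < 1) (n : ℤ) :
    Filter.Tendsto (fun N : ℕ ↦ gaussBinom q (2 * N) (N + n).toNat) Filter.atTop
      (nhds (∏' j : ℕ, (1 - q * q ^ j))⁻¹) := by
  have hE := tendsto_qFac hq
  have hE0 := tprod_one_sub_mul_pow_ne_zero hq (mul_pow_ne_one hq)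
  have hne (n : ℕ) : qFac q n ≠ 0 := by
    refine Finset.prod_ne_zero_iff.mpr fun j _ h ↦ mul_pow_ne_one hq j ?_
    rw [← pow_succ']; linear_combination -h
  have t1 : Filter.Tendsto (fun N : ℕ ↦ 2 * N) Filter.atTop Filter.atTop :=
    Filter.tendsto_atTop_mono (fun N ↦ by simp only [id]; omega) Filter.tendsto_id
  have t2 (n : ℤ) : Filter.Tendsto (fun N : ℕ ↦ ((N : ℤ) + n).toNat) Filter.atTop Filter.atTop := by
    refine Filter.tendsto_atTop.mpr fun b ↦ ?_
    filter_upwards [Filter.eventually_ge_atTop (b + n.natAbs)] with N hN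
    omega
  have key := (hE.comp t1).mul (((hE.comp (t2 n)).inv₀ hE0).mul ((hE.comp (t2 (-n))).inv₀ hE0))
  rw [mul_inv_cancel_left₀ hE0] at key
  refine key.congr' ?_
  filter_upwards [Filter.eventually_ge_atTop n.natAbs] with N hN
  obtain ⟨a, ha⟩ : ∃ a : ℕ, ((N : ℤ) + n).toNat = a := ⟨_, rfl⟩
  obtain ⟨b, hb⟩ : ∃ b : ℕ, ((N : ℤ) + -n).toNat = b := ⟨_, rfl⟩
  have : 2 * N = a + b := by omega
  simp only [Function.comp_apply, ha, hb, this, ← gaussBinom_mul_qFac q a b]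
  field_simp [hne a, hne b]

/-- The **Jacobi triple product** identity. -/
theorem jacobi_triple_product {p y : ℂ} (hp0 : p ≠ 0) (hp : ‖p‖ < 1) (hy : y ≠ 0) :
    ∑' n : ℤ, (-1) ^ n * p ^ (n * (n - 1)) * y ^ n =
      (∏' j : ℕ, (1 - p ^ 2 * (p ^ 2) ^ j)) * ((∏' j : ℕ, (1 - y * (p ^ 2) ^ j)) *
        ∏' j : ℕ, (1 - p ^ 2 / y * (p ^ 2) ^ j)) := by
  have hq : ‖p ^ 2‖ < 1 := by
    rw [norm_pow]; exact pow_lt_one₀ (norm_nonneg p) hp two_ne_zero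
  have hE0 := tprod_one_sub_mul_pow_ne_zero hq (mul_pow_ne_one hq)
  obtain ⟨C, hC⟩ := exists_norm_gaussBinom_le hq
  have hC0 := (norm_nonneg _).trans (hC 0 0)
  have hlim : Filter.Tendsto (fun N : ℕ ↦ ∑' n : ℤ, if n ∈ Finset.Icc (-N : ℤ) N then
      (-1) ^ n * p ^ (n * (n - 1)) * y ^ n * gaussBinom (p ^ 2) (2 * N) (N + n).toNat else 0)
      Filter.atTop (nhds (∑' n : ℤ, (-1) ^ n * p ^ (n * (n - 1)) * y ^ n *
        (∏' j : ℕ, (1 - p ^ 2 * (p ^ 2) ^ j))⁻¹)) := by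
    refine tendsto_tsum_of_dominated_convergence
      ((summable_zpow_triple hp0 hp hy).mul_right C) (fun n ↦ ?_) (.of_forall fun N n ↦ ?_)
    · refine ((tendsto_gaussBinom hq n).const_mul _).congr' ?_
      filter_upwards [Filter.eventually_ge_atTop n.natAbs] with N hN
      rw [if_pos (by rw [Finset.mem_Icc]; omega)]
    · split_ifs with h
      · rw [Finset.mem_Icc] at h
        have h2 : 2 * N = ((N : ℤ) + n).toNat + ((N : ℤ) - n).toNat := by omega
        rw [norm_mul]
        gcongr
        rw [h2]
        exact hC _ _
      · rw [norm_zero]; positivity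
  have hlim2 := ((multipliable_one_sub_mul_pow hq y).hasProd.tendsto_prod_nat).mul
    ((multipliable_one_sub_mul_pow hq (p ^ 2 / y)).hasProd.tendsto_prod_nat)
  have heq := tendsto_nhds_unique (hlim.congr fun N ↦ ?_) hlim2
  · rw [tsum_mul_right] at heq
    rw [← heq]
    field_simp
  · rw [tsum_eq_sum (s := Finset.Icc (-N : ℤ) N) (fun n hn ↦ if_neg hn), ]
    rw [Finset.sum_congr rfl (fun n hn ↦ if_pos hn), ← prod_mul_prod_eq_sum_gaussBinom hp0 hy]
    congr 1
    refine Finset.prod_congr rfl fun j _ ↦ ?_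
    rw [pow_succ]; ring

/-- Euler's **pentagonal number theorem** for complex numbers. -/
theorem tprod_one_sub_pow_eq_tsum_zpow {p : ℂ} (hp0 : p ≠ 0) (hp : ‖p‖ < 1) :
    ∏' j : ℕ, (1 - p ^ 2 * (p ^ 2) ^ j) = ∑' n : ℤ, (-1) ^ n * p ^ (n * (3 * n + 1)) := by
  have h3 (k : ℕ) (hk : k ≠ 0) : ‖p ^ k‖ < 1 := by
    rw [norm_pow]; exact pow_lt_one₀ (norm_nonneg p) hp hk
  have hJ := jacobi_triple_product (pow_ne_zero 3 hp0) (h3 3 (by norm_num)) (pow_ne_zero 2 hp0)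
  have hL : ∑' n : ℤ, (-1) ^ n * (p ^ 3) ^ (n * (n - 1)) * (p ^ 2) ^ n =
      ∑' n : ℤ, (-1) ^ n * p ^ (n * (3 * n + 1)) := by
    rw [← (Equiv.neg ℤ).tsum_eq]
    refine tsum_congr fun n ↦ ?_
    rw [Equiv.neg_apply, mul_assoc, ← zpow_natCast, ← zpow_natCast, ← zpow_mul, ← zpow_mul,
      ← zpow_add₀ hp0, zpow_neg, ← inv_zpow, inv_neg, inv_one]
    congr 2; push_cast; ring
  rw [← hL, hJ]
  have hq : ‖(p ^ 3) ^ 2‖ < 1 := by rw [← pow_mul]; exact h3 _ (by norm_num)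
  have t1 := (multipliable_one_sub_mul_pow hq ((p ^ 3) ^ 2)).hasProd.tendsto_prod_nat
  have t2 := (multipliable_one_sub_mul_pow hq (p ^ 2)).hasProd.tendsto_prod_nat
  have t3 := (multipliable_one_sub_mul_pow hq ((p ^ 3) ^ 2 / p ^ 2)).hasProd.tendsto_prod_nat
  have t4 := (multipliable_one_sub_mul_pow (h3 2 two_ne_zero) (p ^ 2)).hasProd.tendsto_prod_nat
  have t5 : Filter.Tendsto (fun N : ℕ ↦ 3 * N) Filter.atTop Filter.atTop :=
    Filter.tendsto_atTop_mono (fun N ↦ by simp only [id]; omega) Filter.tendsto_id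
  refine tendsto_nhds_unique (t4.comp t5) ((t1.mul (t2.mul t3)).congr fun N ↦ ?_)
  simp only [Function.comp_apply]
  induction N with
  | zero => simp
  | succ N ih =>
    rw [show 3 * (N + 1) = 3 * N + 1 + 1 + 1 by ring]
    simp only [Finset.prod_range_succ]
    rw [← ih, show (p ^ 3) ^ 2 / p ^ 2 = p ^ 4 by field_simp]
    ring

lemma tsum_int_even_add_odd {h : ℤ → ℂ} (hh : Summable h) :
    ∑' n : ℤ, h n = ∑' k : ℤ, h (2 * k) + ∑' k : ℤ, h (2 * k + 1) := by
  have i1 : Function.Injective fun k : ℤ ↦ 2 * k := fun a b h ↦ by simpa using h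
  have i2 : Function.Injective fun k : ℤ ↦ 2 * k + 1 := fun a b h ↦ by simpa using h
  have hc : IsCompl (Set.range fun k : ℤ ↦ 2 * k) (Set.range fun k : ℤ ↦ 2 * k + 1) := by
    have : (Set.range fun k : ℤ ↦ 2 * k + 1) = (Set.range fun k : ℤ ↦ 2 * k)ᶜ := by
      ext n
      simp only [Set.mem_range, Set.mem_compl_iff, not_exists]
      refine ⟨fun ⟨k, hk⟩ j ↦ by omega, fun h ↦ ⟨n / 2, ?_⟩⟩
      have := h (n / 2)
      omega
    exact this ▸ isCompl_compl
  have h1 : HasSum (h ∘ ((↑) : (Set.range fun k : ℤ ↦ 2 * k) → ℤ)) (∑' k : ℤ, h (2 * k)) :=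
    (i1.hasSum_range_iff).mpr (hh.comp_injective i1).hasSum
  have h2 : HasSum (h ∘ ((↑) : (Set.range fun k : ℤ ↦ 2 * k + 1) → ℤ)) (∑' k : ℤ, h (2 * k + 1)) :=
    (i2.hasSum_range_iff).mpr (hh.comp_injective i2).hasSum
  exact (h1.add_isCompl hc h2).tsum_eq

lemma tsum_int_parity_split {h : ℤ → ℂ} (hh : Summable h) (N : ℤ) :
    ∑' n : ℤ, h n = ∑' k : ℤ, h (N - 2 * k) + ∑' k : ℤ, h (-(2 * k + N + 1)) := by
  have hs := tsum_int_even_add_odd ((Equiv.subLeft N).summable_iff.mpr hh)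
  simp only [Function.comp_apply] at hs
  rw [← (Equiv.subLeft N).tsum_eq, hs,
    ← (Equiv.addRight N).tsum_eq (fun k ↦ (Equiv.subLeft N) (2 * k + 1) |> h)]
  simp only [Equiv.subLeft_apply, Equiv.coe_addRight]
  congr 1
  exact tsum_congr fun k ↦ by congr 1; ring

lemma summable_norm_zpow_quadratic_mul_zpow {p w : ℂ} (hp0 : p ≠ 0) (hp : ‖p‖ < 1) (hw : w ≠ 0)
    (k a b c : ℤ) (hk : 0 < k) :
    Summable fun n : ℤ ↦ ‖(-1) ^ n * p ^ (n * (k * n + a)) * w ^ (b * n + c)‖ := by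
  lift k to ℕ using hk.le
  have hpk : ‖p ^ k‖ < 1 := by
    rw [norm_pow]; exact pow_lt_one₀ (norm_nonneg p) hp (by omega)
  refine ((summable_norm_zpow_sq_mul_zpow (pow_ne_zero k hp0) hpk
    (mul_ne_zero (zpow_ne_zero a hp0) (zpow_ne_zero b hw))).mul_right ‖w ^ c‖).congr fun n ↦ ?_
  rw [mul_assoc ((-1) ^ n), norm_mul ((-1) ^ n), norm_zpow (-1 : ℂ), norm_neg, norm_one, one_zpow, one_mul,
    ← norm_mul]
  refine congrArg _ ?_
  rw [zpow_add₀ hw, mul_zpow, ← zpow_natCast, ← zpow_mul, ← zpow_mul, ← zpow_mul,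
    ← mul_assoc, ← mul_assoc, ← zpow_add₀ hp0]
  congr 3; ring

/-- The **quintuple product identity**, as a relation between theta series. -/
theorem quintuple_identity {p w : ℂ} (hp0 : p ≠ 0) (hp : ‖p‖ < 1) (hw : w ≠ 0) :
    (∑' n : ℤ, (-1) ^ n * p ^ (n * (n + 1)) * w ^ (2 * n + 1)) *
      (∑' n : ℤ, (-1) ^ n * p ^ (n * (3 * n + 1)) * (w ^ (6 * n + 1) + w ^ (-(6 * n + 1)))) =
    (∑' n : ℤ, (-1) ^ n * p ^ (n * (3 * n + 1))) *
      ∑' n : ℤ, (-1) ^ n * p ^ (n * (n + 1)) * w ^ (2 * (2 * n + 1)) := by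
  have hf : Summable fun n : ℤ ↦ ‖(-1) ^ n * p ^ (n * (n + 1)) * w ^ (2 * n + 1)‖ := by
    simpa using summable_norm_zpow_quadratic_mul_zpow hp0 hp hw 1 1 2 1 one_pos
  have hg1 := summable_norm_zpow_quadratic_mul_zpow hp0 hp hw 3 1 6 1 (by norm_num)
  have hg2 : Summable fun n : ℤ ↦ ‖(-1) ^ n * p ^ (n * (3 * n + 1)) * w ^ (-(6 * n + 1))‖ := by
    simpa [add_comm] using summable_norm_zpow_quadratic_mul_zpow hp0 hp hw 3 1 (-6) (-1) (by norm_num)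
  have hc : Summable fun n : ℤ ↦ (-1) ^ n * p ^ (n * (3 * n + 1)) := by
    simpa using (summable_norm_zpow_quadratic_mul_zpow hp0 hp hw 3 1 0 0 (by norm_num)).of_norm
  simp only [mul_add ((-1 : ℂ) ^ (_ : ℤ) * p ^ (_ : ℤ))]
  rw [hg1.of_norm.tsum_add hg2.of_norm, mul_add,
    tsum_mul_tsum_of_summable_norm hf hg1, tsum_mul_tsum_of_summable_norm hf hg2]
  have sA := (summable_mul_of_summable_norm hf hg1)
  have sB := (summable_mul_of_summable_norm hf hg2)
  let eA : ℤ × ℤ ≃ ℤ × ℤ :=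
    ⟨fun x ↦ (x.1 - 1 - 3 * x.2, x.2), fun x ↦ (x.1 + 1 + 3 * x.2, x.2),
      fun x ↦ Prod.ext (by simp only []; ring) rfl, fun x ↦ Prod.ext (by simp only []; ring) rfl⟩
  let eB : ℤ × ℤ ≃ ℤ × ℤ :=
    ⟨fun x ↦ (x.1 + 3 * x.2, x.2), fun x ↦ (x.1 - 3 * x.2, x.2),
      fun x ↦ by ext <;> simp, fun x ↦ by ext <;> simp⟩
  rw [← eA.tsum_eq (fun x : ℤ × ℤ ↦ (-1) ^ x.1 * p ^ (x.1 * (x.1 + 1)) * w ^ (2 * x.1 + 1) *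
      ((-1) ^ x.2 * p ^ (x.2 * (3 * x.2 + 1)) * w ^ (6 * x.2 + 1))),
    ← eB.tsum_eq (fun x : ℤ × ℤ ↦ (-1) ^ x.1 * p ^ (x.1 * (x.1 + 1)) * w ^ (2 * x.1 + 1) *
      ((-1) ^ x.2 * p ^ (x.2 * (3 * x.2 + 1)) * w ^ (-(6 * x.2 + 1))))]
  have sA' := eA.summable_iff.mpr sA
  have sB' := eB.summable_iff.mpr sB
  have hm1 : (-1 : ℂ) ≠ 0 := by norm_num
  have hA (M k : ℤ) : ((fun x : ℤ × ℤ ↦ (-1) ^ x.1 * p ^ (x.1 * (x.1 + 1)) * w ^ (2 * x.1 + 1) *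
      ((-1) ^ x.2 * p ^ (x.2 * (3 * x.2 + 1)) * w ^ (6 * x.2 + 1))) ∘ eA) (M, k) =
      -(-1) ^ M * p ^ (M * (M - 1) + 12 * k ^ 2 + 2 * k * (2 - 3 * M)) * w ^ (2 * M) := by
    simp only [Function.comp_apply, eA, Equiv.coe_fn_mk]
    have h1 : (-1 : ℂ) ^ (M - 1 - 3 * k) * (-1) ^ k = -(-1) ^ M := by
      rw [← zpow_add₀ hm1, show M - 1 - 3 * k + k = M + (-1) + 2 * (-k) by ring, zpow_add₀ hm1,
        zpow_mul, zpow_add₀ hm1]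
      simp
    have h2 : p ^ (M * (M - 1) + 12 * k ^ 2 + 2 * k * (2 - 3 * M)) =
        p ^ ((M - 1 - 3 * k) * (M - 1 - 3 * k + 1)) * p ^ (k * (3 * k + 1)) := by
      rw [← zpow_add₀ hp0]; congr 1; ring
    have h3 : w ^ (2 * M) = w ^ (2 * (M - 1 - 3 * k) + 1) * w ^ (6 * k + 1) := by
      rw [← zpow_add₀ hw]; congr 1; ring
    rw [← h1, h2, h3]; ring
  have hB (M k : ℤ) : ((fun x : ℤ × ℤ ↦ (-1) ^ x.1 * p ^ (x.1 * (x.1 + 1)) * w ^ (2 * x.1 + 1) *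
      ((-1) ^ x.2 * p ^ (x.2 * (3 * x.2 + 1)) * w ^ (-(6 * x.2 + 1)))) ∘ eB) (M, k) =
      (-1) ^ M * p ^ (M * (M + 1) + 12 * k ^ 2 + 2 * k * (3 * M + 2)) * w ^ (2 * M) := by
    simp only [Function.comp_apply, eB, Equiv.coe_fn_mk]
    have h1 : (-1 : ℂ) ^ (M + 3 * k) * (-1) ^ k = (-1) ^ M := by
      rw [← zpow_add₀ hm1, show M + 3 * k + k = M + 2 * (2 * k) by ring, zpow_add₀ hm1,
        zpow_mul]
      simp
    have h2 : p ^ (M * (M + 1) + 12 * k ^ 2 + 2 * k * (3 * M + 2)) =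
        p ^ ((M + 3 * k) * (M + 3 * k + 1)) * p ^ (k * (3 * k + 1)) := by
      rw [← zpow_add₀ hp0]; congr 1; ring
    have h3 : w ^ (2 * M) = w ^ (2 * (M + 3 * k) + 1) * w ^ (-(6 * k + 1)) := by
      rw [← zpow_add₀ hw]; congr 1; ring
    rw [← h1, h2, h3]; ring
  have tA := sA'.tsum_prod
  have tB := sB'.tsum_prod
  simp only [Function.comp_apply] at hA hB tA tB
  rw [tA, tB]
  have uA := sA'.prod
  have uB := sB'.prod
  simp only [Function.comp_apply] at uA uB
  simp only [hA] at uA ⊢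
  simp only [hB] at uB ⊢
  rw [← uA.tsum_add uB, ← tsum_mul_left]
  have i2 : Function.Injective fun k : ℤ ↦ 2 * k + 1 := fun a b h ↦ by simpa using h
  rw [← i2.tsum_eq]
  · refine tsum_congr fun N ↦ ?_
    rw [tsum_int_parity_split hc N, add_mul (∑' k : ℤ, _), ← tsum_mul_right, ← tsum_mul_right]
    have s1 : (-1 : ℂ) ^ (2 * N + 1) = -1 := by rw [zpow_add₀ hm1, zpow_mul]; simp
    have s2 : (-1 : ℂ) ^ N * (-1) ^ N = 1 := by rw [← mul_zpow]; simp
    congr 1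
    · refine tsum_congr fun k ↦ ?_
      have s3 : (-1 : ℂ) ^ (N - 2 * k) = (-1) ^ N := by
        rw [zpow_sub₀ hm1, zpow_mul]; simp
      have h2 : p ^ ((2 * N + 1) * (2 * N + 1 - 1) + 12 * k ^ 2 + 2 * k * (2 - 3 * (2 * N + 1))) =
          p ^ ((N - 2 * k) * (3 * (N - 2 * k) + 1)) * p ^ (N * (N + 1)) := by
        rw [← zpow_add₀ hp0]; congr 1; ring
      rw [s1, s3, h2]
      linear_combination -p ^ ((N - 2 * k) * (3 * (N - 2 * k) + 1)) * p ^ (N * (N + 1)) *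
        w ^ (2 * (2 * N + 1)) * s2
    · refine tsum_congr fun k ↦ ?_
      have s3 : (-1 : ℂ) ^ (-(2 * k + N + 1)) = -(-1) ^ N := by
        rw [zpow_neg, ← inv_zpow, zpow_add₀ (by norm_num), zpow_add₀ (by norm_num), zpow_mul]
        norm_num
      have h2 : p ^ ((2 * N + 1) * (2 * N + 1 + 1) + 12 * k ^ 2 + 2 * k * (3 * (2 * N + 1) + 2)) =
          p ^ (-(2 * k + N + 1) * (3 * -(2 * k + N + 1) + 1)) * p ^ (N * (N + 1)) := by
        rw [← zpow_add₀ hp0]; congr 1; ring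
      rw [s1, s3, h2]
      linear_combination p ^ (-(2 * k + N + 1) * (3 * -(2 * k + N + 1) + 1)) * p ^ (N * (N + 1)) *
        w ^ (2 * (2 * N + 1)) * s2
  · intro M hM
    by_contra hodd
    apply hM
    obtain ⟨N, rfl⟩ : ∃ N, M = 2 * N := by
      rcases Int.even_or_odd' M with ⟨N, h | h⟩
      · exact ⟨N, h⟩
      · exact absurd ⟨N, h.symm⟩ hodd
    simp only []
    rw [← (Equiv.addRight N).tsum_eq, ← neg_eq_iff_add_eq_zero, ← tsum_neg]
    refine tsum_congr fun k ↦ ?_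
    simp only [Equiv.coe_addRight]
    rw [neg_mul, neg_mul, neg_neg]
    congr 3; ring

/-- The series of `θ₁` does not vanish on the unit circle away from `w² = 1`. -/
lemma tsum_theta_ne_zero {p w : ℂ} (hp0 : p ≠ 0) (hp : ‖p‖ < 1) (hw : ‖w‖ = 1) (hw2 : w ^ 2 ≠ 1) :
    ∑' n : ℤ, (-1) ^ n * p ^ (n * (n + 1)) * w ^ (2 * n + 1) ≠ 0 := by
  have hw0 : w ≠ 0 := norm_pos_iff.mp (by rw [hw]; exact one_pos)
  have hq : ‖p ^ 2‖ < 1 := by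
    rw [norm_pow]; exact pow_lt_one₀ (norm_nonneg p) hp two_ne_zero
  have hlt (j : ℕ) : ‖p ^ 2‖ ^ (j + 1) ≠ 1 := (pow_lt_one₀ (norm_nonneg _) hq j.succ_ne_zero).ne
  have hJ := jacobi_triple_product hp0 hp (mul_ne_zero (pow_ne_zero 2 hw0) (pow_ne_zero 2 hp0))
  have hS : ∑' n : ℤ, (-1) ^ n * p ^ (n * (n + 1)) * w ^ (2 * n + 1) =
      w * ∑' n : ℤ, (-1) ^ n * p ^ (n * (n - 1)) * (w ^ 2 * p ^ 2) ^ n := by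
    rw [← tsum_mul_left]
    refine tsum_congr fun n ↦ ?_
    rw [show n * (n + 1) = n * (n - 1) + 2 * n by ring, zpow_add₀ hp0, zpow_add₀ hw0, mul_zpow,
      zpow_mul p 2 n, zpow_mul w 2 n, zpow_one]
    simp only [zpow_ofNat]
    ring
  rw [hS, hJ]
  refine mul_ne_zero hw0 (mul_ne_zero (tprod_one_sub_mul_pow_ne_zero hq (mul_pow_ne_one hq))
    (mul_ne_zero (tprod_one_sub_mul_pow_ne_zero hq fun j h ↦ hlt j ?_)
      (tprod_one_sub_mul_pow_ne_zero hq fun j h ↦ ?_)))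
  · have := congrArg norm h
    rw [mul_assoc, ← pow_succ', norm_mul, norm_pow w, hw, norm_pow, norm_one] at this
    simpa using this
  · have h' : (p ^ 2) ^ j = w ^ 2 := by
      have := pow_ne_zero 2 hp0
      have := pow_ne_zero 2 hw0
      field_simp at h
      exact h
    rcases j with _ | j
    · exact hw2 (by rw [← h', pow_zero])
    · have := congrArg norm h'
      rw [norm_pow, norm_pow w, hw, one_pow] at this
      exact hlt j this

lemma tprod_mul_theta1_two_mul_div {τ : ℂ} (hτ : 0 < τ.im) {z : ℂ} (hz : ‖exp (I * z)‖ = 1)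
    (hz2 : exp (I * z) ^ 2 ≠ 1) :
    (∏' n : ℕ, (1 - qq τ ^ (n + 1))) * (theta1 (2 * z) τ / theta1 z τ) =
      ∑' n : ℤ, (-1 : ℂ) ^ n * exp (piC * I * τ * n * (3 * n + 1)) *
        (exp (I * z) ^ (6 * n + 1) + exp (I * z) ^ (-(6 * n + 1))) := by
  set p := exp (piC * I * τ) with hpdef
  set w := exp (I * z) with hwdef
  have hp0 : p ≠ 0 := exp_ne_zero _
  have hw0 : w ≠ 0 := exp_ne_zero _
  have hp : ‖p‖ < 1 := by
    rw [hpdef, norm_exp, Real.exp_lt_one_iff]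
    simp only [piC, mul_re, mul_im, ofReal_re, ofReal_im, I_re, I_im]
    nlinarith [mul_pos Real.pi_pos hτ]
  have hpz (n a : ℤ) : exp (piC * I * τ * n * (a * n + 1)) = p ^ (n * (a * n + 1)) := by
    rw [hpdef, ← exp_int_mul]; push_cast; ring_nf
  have h1 : ∑' n : ℤ, (-1 : ℂ) ^ n * exp (piC * I * τ * n * (n + 1)) *
      exp ((2 * n + 1) * I * z) = ∑' n : ℤ, (-1) ^ n * p ^ (n * (n + 1)) * w ^ (2 * n + 1) := by
    refine tsum_congr fun n ↦ ?_
    rw [hpdef, hwdef, ← exp_int_mul, ← exp_int_mul]; push_cast; ring_nf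
  have h2 : ∑' n : ℤ, (-1 : ℂ) ^ n * exp (piC * I * τ * n * (n + 1)) *
      exp ((2 * n + 1) * I * (2 * z)) =
      ∑' n : ℤ, (-1) ^ n * p ^ (n * (n + 1)) * w ^ (2 * (2 * n + 1)) := by
    refine tsum_congr fun n ↦ ?_
    rw [hpdef, hwdef, ← exp_int_mul, ← exp_int_mul]; push_cast; ring_nf
  have hS := tsum_theta_ne_zero hp0 hp hz hz2
  have hE : ∏' n : ℕ, (1 - qq τ ^ (n + 1)) = ∑' n : ℤ, (-1) ^ n * p ^ (n * (3 * n + 1)) := by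
    rw [← tprod_one_sub_pow_eq_tsum_zpow hp0 hp]
    refine tprod_congr fun n ↦ ?_
    rw [← pow_succ', qq, hpdef, ← exp_nat_mul _ 2]
    push_cast; ring_nf
  have hpre : -I * exp (piC * I * τ / 4) ≠ 0 := mul_ne_zero (neg_ne_zero.mpr I_ne_zero) (exp_ne_zero _)
  rw [theta1, theta1, h1, h2, mul_div_mul_left _ _ hpre, hE, ← mul_div_assoc,
    ← quintuple_identity hp0 hp hw0, mul_div_cancel_left₀ _ hS]
  exact tsum_congr fun n ↦ by rw [← hpz n 3]; norm_cast

section QuadraticGaussSum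

open Filter Topology

lemma ofReal_mul_cpow_half {t : ℝ} (ht : 0 < t) {x : ℂ} (hx : x ≠ 0) :
    (t * x) ^ (1 / 2 : ℂ) = Real.sqrt t * x ^ (1 / 2 : ℂ) := by
  have ht' : (t : ℂ) ≠ 0 := by exact_mod_cast ht.ne'
  rw [cpow_def_of_ne_zero (mul_ne_zero ht' hx), cpow_def_of_ne_zero hx, log_ofReal_mul ht hx,
    add_mul, exp_add, Real.sqrt_eq_rpow, ofReal_cpow ht.le, cpow_def_of_ne_zero ht', ofReal_log ht.le]
  norm_num

lemma tendsto_jacobiTheta_one {α : Type*} {l : Filter α} {f : α → ℂ}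
    (hf : Tendsto (fun a ↦ (f a).im) l atTop) : Tendsto (fun a ↦ jacobiTheta (f a)) l (𝓝 1) := by
  have h0 : Tendsto (fun τ : ℂ ↦ jacobiTheta τ - 1) (comap im atTop) (𝓝 0) := by
    refine isBigO_at_im_infty_jacobiTheta_sub_one.trans_tendsto ?_
    refine Real.tendsto_exp_atBot.comp ?_
    exact tendsto_comap.const_mul_atTop_of_neg (neg_lt_zero.mpr Real.pi_pos)
  have := (h0.comp (tendsto_comap_iff.mpr hf)).add_const 1
  simpa using this

lemma jacobiTheta_functional_equation (τ : ℂ) :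
    jacobiTheta τ = 1 / (-I * τ) ^ (1 / 2 : ℂ) * jacobiTheta (-1 / τ) := by
  rw [jacobiTheta_eq_jacobiTheta₂, jacobiTheta_eq_jacobiTheta₂, jacobiTheta₂_functional_equation]
  simp

lemma tendsto_sqrt_mul_jacobiTheta {σ : ℝ → ℂ} {c : ℂ} (hc : c ∈ slitPlane)
    (hσ : Tendsto (fun t : ℝ ↦ -I * σ t / t) (𝓝[>] 0) (𝓝 c))
    (him : Tendsto (fun t ↦ (-1 / σ t).im) (𝓝[>] 0) atTop) :
    Tendsto (fun t : ℝ ↦ (Real.sqrt t : ℂ) * jacobiTheta (σ t)) (𝓝[>] 0)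
      (𝓝 (1 / c ^ (1 / 2 : ℂ))) := by
  have hcc : c ^ (1 / 2 : ℂ) ≠ 0 := by
    rw [cpow_def_of_ne_zero (slitPlane_ne_zero hc)]; exact exp_ne_zero _
  have h1 := ((continuousAt_cpow_const (b := 1 / 2) hc).tendsto.comp hσ)
  have h2 := ((tendsto_const_nhds (x := (1 : ℂ))).div h1 hcc).mul (tendsto_jacobiTheta_one him)
  rw [mul_one] at h2
  refine h2.congr' ?_
  filter_upwards [self_mem_nhdsWithin, hσ.eventually_ne (slitPlane_ne_zero hc)] with t ht hne
  have ht0 : (0 : ℝ) < t := ht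
  have hs : (Real.sqrt t : ℂ) ≠ 0 := by exact_mod_cast (Real.sqrt_pos.mpr ht0).ne'
  have ht' : (t : ℂ) ≠ 0 := by exact_mod_cast ht0.ne'
  have hx : -I * σ t = t * (-I * σ t / t) := by field_simp
  simp only [Pi.div_apply, Function.comp_apply]
  rw [jacobiTheta_functional_equation (σ t), ← mul_assoc, hx, ofReal_mul_cpow_half ht0 hne, ← hx]
  congr 1
  rw [mul_one_div, ← div_div, div_self hs]

lemma tsum_int_eq_sum_residues {f : ℤ → ℂ} (hf : Summable f) (N : ℕ) [NeZero N] :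
    ∑' n : ℤ, f n = ∑ r ∈ Finset.range N, ∑' k : ℤ, f (k * N + r) := by
  have hs : Summable (f ∘ (Int.divModEquiv N).symm) := (Int.divModEquiv N).symm.summable_iff.mpr hf
  have hs' : Summable ((f ∘ (Int.divModEquiv N).symm) ∘ (Equiv.prodComm (Fin N) ℤ)) :=
    (Equiv.prodComm (Fin N) ℤ).summable_iff.mpr hs
  rw [← (Int.divModEquiv N).symm.tsum_eq, ← (Equiv.prodComm (Fin N) ℤ).tsum_eq]
  refine (hs'.tsum_prod).trans ?_
  rw [tsum_fintype, Finset.sum_range]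
  rfl

lemma summable_jacobiTheta {τ : ℂ} (hτ : 0 < τ.im) :
    Summable fun n : ℤ ↦ exp (Real.pi * I * (n : ℂ) ^ 2 * τ) := by
  simpa [jacobiTheta₂_term] using (hasSum_jacobiTheta₂_term 0 hτ).summable

lemma jacobiTheta_two_div_add (N : ℕ) [NeZero N] {t : ℝ} (ht : 0 < t) :
    jacobiTheta (2 / N + I * t) = ∑ r ∈ Finset.range N, exp (2 * Real.pi * I * (r ^ 2 : ℤ) / N) *
      HurwitzZeta.evenKernel ((r / N : ℝ) : UnitAddCircle) (t * N ^ 2) := by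
  have hN : (N : ℂ) ≠ 0 := by exact_mod_cast NeZero.ne N
  have hN' : (0 : ℝ) < N := by exact_mod_cast NeZero.pos N
  have him : 0 < (2 / N + I * t : ℂ).im := by
    rw [add_im, show (2 / N : ℂ) = ((2 / N : ℝ) : ℂ) by push_cast; rfl, ofReal_im]; simpa using ht
  rw [jacobiTheta, tsum_int_eq_sum_residues (summable_jacobiTheta him) N]
  refine Finset.sum_congr rfl fun r _ ↦ ?_
  rw [← (HurwitzZeta.hasSum_int_evenKernel (r / N : ℝ)
    (by positivity : 0 < t * (N : ℝ) ^ 2)).tsum_eq, ofReal_tsum, ← tsum_mul_left]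
  refine tsum_congr fun k ↦ ?_
  rw [ofReal_exp, ← exp_add]
  refine exp_eq_exp_iff_exists_int.mpr ⟨k * (k * N + 2 * r), ?_⟩
  push_cast
  field_simp
  linear_combination ((t : ℂ) * N * (k * N + r) ^ 2) * I_sq

lemma tendsto_sqrt_mul_evenKernel (a : UnitAddCircle) {c : ℝ} (hc : 0 < c) :
    Tendsto (fun t : ℝ ↦ Real.sqrt t * HurwitzZeta.evenKernel a (t * c ^ 2)) (𝓝[>] 0) (𝓝 (1 / c)) := by
  obtain ⟨b, hb, hO⟩ := HurwitzZeta.isBigO_atTop_cosKernel_sub a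
  have h0 : Tendsto (fun x ↦ HurwitzZeta.cosKernel a x - 1) atTop (𝓝 0) :=
    hO.trans_tendsto (Real.tendsto_exp_atBot.comp
      (tendsto_id.const_mul_atTop_of_neg (neg_lt_zero.mpr hb)))
  have h1 : Tendsto (fun t : ℝ ↦ 1 / (t * c ^ 2)) (𝓝[>] 0) atTop := by
    have := (tendsto_inv_nhdsGT_zero (𝕜 := ℝ)).const_mul_atTop (by positivity : 0 < (c ^ 2)⁻¹)
    refine this.congr fun t ↦ ?_
    rw [one_div, mul_inv, mul_comm]
  have h2 := ((h0.comp h1).add_const 1).const_mul (1 / c)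
  rw [zero_add, mul_one] at h2
  refine h2.congr' ?_
  filter_upwards [self_mem_nhdsWithin] with t ht
  have ht0 : (0 : ℝ) < t := ht
  have hs := Real.sqrt_pos.mpr ht0
  rw [HurwitzZeta.evenKernel_functional_equation, ← Real.sqrt_eq_rpow, Real.sqrt_mul ht0.le,
    Real.sqrt_sq hc.le]
  simp only [Function.comp_apply]
  field_simp
  ring

lemma tendsto_sqrt_mul_jacobiTheta_two_div_add (N : ℕ) [NeZero N] :
    Tendsto (fun t : ℝ ↦ (Real.sqrt t : ℂ) * jacobiTheta (2 / N + I * t)) (𝓝[>] 0)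
      (𝓝 (∑ r ∈ Finset.range N, exp (2 * Real.pi * I * (r ^ 2 : ℤ) / N) * (1 / N : ℝ))) := by
  have hN' : (0 : ℝ) < N := by exact_mod_cast NeZero.pos N
  have h := tendsto_finsetSum (Finset.range N) fun r _ ↦
    ((continuous_ofReal.tendsto _).comp (tendsto_sqrt_mul_evenKernel
      ((r / N : ℝ) : UnitAddCircle) hN')).const_mul (exp (2 * Real.pi * I * (r ^ 2 : ℤ) / N))
  refine h.congr' ?_
  filter_upwards [self_mem_nhdsWithin] with t ht
  rw [jacobiTheta_two_div_add N ht, Finset.mul_sum]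
  refine Finset.sum_congr rfl fun r _ ↦ ?_
  simp only [Function.comp_apply, ofReal_mul]
  ring

lemma jacobiTheta_neg_div_two_add (N : ℕ) {σ : ℂ} (hσ : 0 < σ.im) :
    jacobiTheta (-N / 2 + σ) =
      jacobiTheta (4 * σ) + (-I) ^ N * (jacobiTheta σ - jacobiTheta (4 * σ)) := by
  have him : 0 < (-N / 2 + σ : ℂ).im := by
    rw [add_im, show (-N / 2 : ℂ) = ((-N / 2 : ℝ) : ℂ) by push_cast; rfl, ofReal_im]; simpa using hσ
  have he : ∑' k : ℤ, exp (Real.pi * I * ((2 * k : ℤ) : ℂ) ^ 2 * σ) = jacobiTheta (4 * σ) := by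
    rw [jacobiTheta]
    refine tsum_congr fun k ↦ ?_
    push_cast; ring_nf
  have hI : exp (-(Real.pi * I) / 2) = -I := by
    rw [show -(Real.pi * I) / 2 = -(Real.pi / 2 * I) by ring, exp_neg, exp_pi_div_two_mul_I, inv_I]
  have h1 := tsum_int_even_add_odd (summable_jacobiTheta him)
  have h2 := tsum_int_even_add_odd (summable_jacobiTheta hσ)
  rw [he] at h2
  rw [← jacobiTheta] at h1 h2
  rw [h1, h2, add_sub_cancel_left, ← he, ← tsum_mul_left]
  congr 1
  · refine tsum_congr fun k ↦ exp_eq_exp_iff_exists_int.mpr ⟨-(k ^ 2 * N), ?_⟩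
    push_cast; ring
  · refine tsum_congr fun k ↦ ?_
    rw [← hI, ← exp_nat_mul, ← exp_add]
    refine exp_eq_exp_iff_exists_int.mpr ⟨-((k ^ 2 + k) * N), ?_⟩
    push_cast; ring

/-- Evaluation of the **quadratic Gauss sum**, including its sign. -/
theorem sum_exp_sq (N : ℕ) [NeZero N] :
    ∑ r ∈ Finset.range N, exp (2 * Real.pi * I * (r ^ 2 : ℤ) / N) =
      Real.sqrt N * ((1 + I) * (1 + (-I) ^ N) / 2) := by
  have hN : (N : ℂ) ≠ 0 := by exact_mod_cast NeZero.ne N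
  have hN' : (0 : ℝ) < N := by exact_mod_cast NeZero.pos N
  set τ : ℝ → ℂ := fun t ↦ 2 / N + I * t with hτ
  set σ : ℝ → ℂ := fun t ↦ N * I * t / 2 / τ t with hσ
  have hτim (t : ℝ) : (τ t).im = t := by
    rw [hτ]
    simp only [add_im]
    rw [show (2 / N : ℂ) = ((2 / N : ℝ) : ℂ) by push_cast; rfl, ofReal_im]; simp
  have hτ0 : Tendsto τ (𝓝[>] 0) (𝓝 (2 / N)) := by
    have : Continuous τ := by fun_prop
    have := (this.tendsto 0).mono_left (nhdsWithin_le_nhds (s := Set.Ioi 0))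
    simpa [hτ] using this
  have hinv : Tendsto (fun t : ℝ ↦ 4 / N ^ 2 * t⁻¹) (𝓝[>] 0) atTop :=
    (tendsto_inv_nhdsGT_zero (𝕜 := ℝ)).const_mul_atTop (by positivity)
  have hτne (t : ℝ) (ht : 0 < t) : τ t ≠ 0 := fun h ↦ ht.ne' (by rw [← hτim t, h, zero_im])
  have hσinv (t : ℝ) (ht : 0 < t) : -1 / σ t = ((4 / N ^ 2 * t⁻¹ : ℝ) : ℂ) * I + ((-2 / N : ℝ) : ℂ) := by
    have := hτne t ht
    have ht' : (t : ℂ) ≠ 0 := by exact_mod_cast ht.ne'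
    rw [hσ]
    push_cast
    field_simp
    rw [hτ]
    field_simp
    linear_combination (-4 : ℂ) * I_sq
  have hσim (t : ℝ) (ht : 0 < t) : (-1 / σ t).im = 4 / N ^ 2 * t⁻¹ := by
    rw [hσinv t ht, add_im, ofReal_im, add_zero, im_ofReal_mul, I_im, mul_one]
  have hσpos (t : ℝ) (ht : 0 < t) : 0 < (σ t).im := by
    have h : 0 < (-1 / σ t).im := by rw [hσim t ht]; positivity
    have h' : σ t = -(-1 / σ t)⁻¹ := by rw [neg_div, one_div, inv_neg, inv_inv, neg_neg]
    rw [h', neg_im, inv_im, neg_div, neg_neg]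
    exact div_pos h (normSq_pos.mpr fun h0 ↦ by simp [h0] at h)
  have hcpow (x : ℝ) (hx : 0 < x) : ((x : ℂ) ^ 2) ^ (1 / 2 : ℂ) = x := by
    rw [one_div]; exact sq_cpow_two_inv (by simpa using hx)
  have hslope (d : ℂ) : Tendsto (fun t : ℝ ↦ -I * (d * σ t) / t) (𝓝[>] 0)
      (𝓝 (d * (N / 2) / (2 / N))) := by
    refine ((tendsto_const_nhds (x := d * (N / 2 : ℂ))).div hτ0 (by simp [hN])).congr' ?_
    filter_upwards [self_mem_nhdsWithin] with t ht
    have := hτne t ht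
    have ht' : (t : ℂ) ≠ 0 := by exact_mod_cast (show (0 : ℝ) < t from ht).ne'
    simp only [hσ, Pi.div_apply]
    field_simp
    linear_combination d * I_sq
  have lim1 : Tendsto (fun t : ℝ ↦ (Real.sqrt t : ℂ) * jacobiTheta (σ t)) (𝓝[>] 0) (𝓝 (2 / N)) := by
    have hc : (1 : ℂ) * (N / 2) / (2 / N) = ((N / 2 : ℝ) : ℂ) ^ 2 := by
      push_cast; field_simp
    have h := hslope 1
    simp only [one_mul ((_ : ℝ → ℂ) _)] at h
    rw [hc] at h
    convert tendsto_sqrt_mul_jacobiTheta ?_ h ?_ using 2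
    · rw [hcpow _ (by positivity)]; push_cast; rw [one_div_div]
    · rw [← ofReal_pow]; exact ofReal_mem_slitPlane.mpr (by positivity)
    · refine hinv.congr' ?_
      filter_upwards [self_mem_nhdsWithin] with t ht using (hσim t ht).symm
  have lim2 : Tendsto (fun t : ℝ ↦ (Real.sqrt t : ℂ) * jacobiTheta (4 * σ t)) (𝓝[>] 0)
      (𝓝 (1 / N)) := by
    have hc : (4 : ℂ) * (N / 2) / (2 / N) = ((N : ℝ) : ℂ) ^ 2 := by
      push_cast; field_simp; ring
    have h := hslope 4
    rw [hc] at h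
    convert tendsto_sqrt_mul_jacobiTheta ?_ h ?_ using 2
    · rw [hcpow _ (by positivity)]; push_cast; rfl
    · rw [← ofReal_pow]; exact ofReal_mem_slitPlane.mpr (by positivity)
    · refine (hinv.const_mul_atTop (by norm_num : (0 : ℝ) < 1 / 4)).congr' ?_
      filter_upwards [self_mem_nhdsWithin] with t ht
      rw [← hσim t ht, mul_comm (4 : ℂ), ← div_div, show (4 : ℂ) = ((4 : ℝ) : ℂ) by norm_num,
        div_ofReal_im]
      ring
  have hval : (-I * (2 / N) : ℂ) = ((1 - I) / Real.sqrt N) ^ 2 := by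
    have : (Real.sqrt N : ℂ) ^ 2 = N := by exact_mod_cast Real.sq_sqrt hN'.le
    rw [div_pow, this]
    linear_combination (-1 / N : ℂ) * I_sq
  have hsN : (Real.sqrt N : ℂ) ≠ 0 := by exact_mod_cast (Real.sqrt_pos.mpr hN').ne'
  have hroot : (-I * (2 / N) : ℂ) ^ (1 / 2 : ℂ) = (1 - I) / Real.sqrt N := by
    rw [hval, one_div]
    refine sq_cpow_two_inv ?_
    rw [div_ofReal_re]
    simpa using hN'
  have hslit : (-I * (2 / N) : ℂ) ∈ slitPlane := by
    refine Or.inr ?_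
    rw [show (2 / N : ℂ) = ((2 / N : ℝ) : ℂ) by push_cast; rfl, im_mul_ofReal]
    simp [hN'.ne']
  have h1I : (1 - I : ℂ) ≠ 0 := fun h ↦ by simpa using congrArg re h
  have hlim := tendsto_nhds_unique (tendsto_sqrt_mul_jacobiTheta_two_div_add N)
    (b := 1 / (-I * (2 / N)) ^ (1 / 2 : ℂ) * (1 / N + (-I) ^ N * (2 / N - 1 / N))) ?_
  · rw [← Finset.sum_mul, hroot] at hlim
    push_cast at hlim ⊢
    field_simp at hlim
    refine mul_right_cancel₀ h1I (hlim.trans ?_)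
    linear_combination ((Real.sqrt N : ℂ) * (1 + (-I) ^ N) / 2) * I_sq
  · have h0 : Tendsto (fun t ↦ 1 / (-I * τ t) ^ (1 / 2 : ℂ)) (𝓝[>] 0)
        (𝓝 (1 / (-I * (2 / N)) ^ (1 / 2 : ℂ))) :=
      tendsto_const_nhds.div ((continuousAt_cpow_const hslit).tendsto.comp (hτ0.const_mul (-I)))
        (by rw [hroot]; exact div_ne_zero h1I hsN)
    refine (h0.mul (lim2.add ((lim1.sub lim2).const_mul ((-I) ^ N)))).congr' ?_
    filter_upwards [self_mem_nhdsWithin] with t ht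
    have := hτne t ht
    have hinvτ : -1 / τ t = -N / 2 + σ t := by
      rw [hσ]
      field_simp
      rw [hτ]
      field_simp
      ring
    rw [show (2 / N + I * t : ℂ) = τ t from rfl, jacobiTheta_functional_equation (τ t), hinvτ,
      jacobiTheta_neg_div_two_add N (hσpos t ht)]
    ring

end QuadraticGaussSum

section JacobiGaussSum

lemma sum_range_natCast_zmod {M : Type*} [AddCommMonoid M] (m : ℕ) [NeZero m] (f : ZMod m → M) :
    ∑ k ∈ Finset.range m, f k = ∑ x, f x :=
  Finset.sum_nbij' (fun k ↦ (k : ZMod m)) ZMod.val (by simp) (by simp [ZMod.val_lt])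
    (fun k hk ↦ ZMod.val_cast_of_lt (Finset.mem_range.mp hk)) (by simp) (by simp)

/-- The factor `1` or `i` in the evaluation of quadratic Gauss sums. -/
def gaussFactor (m : ℕ) : ℂ := if m % 4 = 1 then 1 else I

lemma sum_exp_sq_of_odd (N : ℕ) (hN : Odd N) :
    ∑ r ∈ Finset.range N, exp (2 * Real.pi * I * (r ^ 2 : ℤ) / N) =
      gaussFactor N * Real.sqrt N := by
  have : NeZero N := ⟨hN.pos.ne'⟩
  rw [sum_exp_sq, gaussFactor, mul_comm]
  congr 1
  have h4 : (-I : ℂ) ^ 4 = 1 := by rw [neg_pow, I_pow_four]; norm_num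
  have h : (-I : ℂ) ^ N = (-I) ^ (N % 4) := by
    conv_lhs => rw [← Nat.div_add_mod N 4, pow_add, pow_mul, h4, one_pow, one_mul]
  have hmod : N % 4 = 1 ∨ N % 4 = 3 := by
    have := Nat.odd_iff.mp hN; omega
  rw [h]
  rcases hmod with h1 | h3
  · rw [h1, if_pos rfl]
    linear_combination (-1 / 2 : ℂ) * I_sq
  · rw [h3, if_neg (by norm_num)]
    linear_combination ((1 - I - I ^ 2) / 2 : ℂ) * I_sq

lemma sum_legendre_mul_exp (p : ℕ) [Fact p.Prime] (hp : p ≠ 2) (c : ℤ) :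
    ∑ k ∈ Finset.range p, (jacobiSym k p : ℂ) * exp (2 * Real.pi * I * (c * k : ℤ) / p) =
      jacobiSym c p * (gaussFactor p * Real.sqrt p) := by
  have hodd : Odd p := (Fact.out : p.Prime).odd_of_ne_two hp
  have hchar : ringChar (ZMod p) ≠ 2 := by rwa [ZMod.ringChar_zmod_n]
  set χ : MulChar (ZMod p) ℂ := (quadraticChar (ZMod p)).ringHomComp (Int.castRingHom ℂ) with hχ
  have hJ (a : ℤ) : (jacobiSym a p : ℂ) = χ a := by
    rw [← jacobiSym.legendreSym.to_jacobiSym, legendreSym]; rfl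
  have hχ1 : χ ≠ 1 := by
    rw [hχ, MulChar.ringHomComp_ne_one_iff Int.cast_injective]
    exact quadraticChar_ne_one hchar
  have hbase : gaussSum χ ZMod.stdAddChar = gaussFactor p * Real.sqrt p := by
    rw [← sum_exp_sq_of_odd p hodd]
    have h1 : ∑ x : ZMod p, (ZMod.stdAddChar x : ℂ) = 0 :=
      AddChar.sum_eq_zero_of_ne_one (by simpa using ZMod.isPrimitive_stdAddChar p one_ne_zero)
    have h2 : gaussSum χ ZMod.stdAddChar =
        ∑ x : ZMod p, ((χ x : ℂ) + 1) * (ZMod.stdAddChar x : ℂ) := by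
      simp_rw [add_mul, one_mul, Finset.sum_add_distrib, h1, add_zero, gaussSum]
    have h3 (x : ZMod p) : (χ x : ℂ) + 1 = ∑ y : ZMod p, if y ^ 2 = x then 1 else 0 := by
      have := quadraticChar_card_sqrts hchar x
      rw [Finset.sum_boole]
      have h' : (Finset.univ.filter fun y : ZMod p ↦ y ^ 2 = x) = {y | y ^ 2 = x}.toFinset := by
        ext; simp
      rw [h', ← Int.cast_natCast, this, Int.cast_add, Int.cast_one]
      rfl
    rw [h2]
    simp_rw [h3, Finset.sum_mul]
    rw [Finset.sum_comm]
    simp_rw [ite_mul, one_mul, zero_mul, Finset.sum_ite_eq, Finset.mem_univ, if_true]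
    rw [← sum_range_natCast_zmod p fun y ↦ (ZMod.stdAddChar (y ^ 2) : ℂ)]
    refine Finset.sum_congr rfl fun r _ ↦ ?_
    rw [← ZMod.stdAddChar_coe]
    push_cast
    rfl
  have hsum : ∑ k ∈ Finset.range p, (jacobiSym k p : ℂ) * exp (2 * Real.pi * I * (c * k : ℤ) / p) =
      gaussSum χ (ZMod.stdAddChar.mulShift (c : ZMod p)) := by
    rw [gaussSum, ← sum_range_natCast_zmod p]
    refine Finset.sum_congr rfl fun k _ ↦ ?_
    rw [hJ, ← ZMod.stdAddChar_coe, AddChar.mulShift_apply]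
    push_cast
    rfl
  rw [hsum, hJ]
  by_cases hc : (c : ZMod p) = 0
  · rw [hc, AddChar.mulShift_zero, gaussSum_one_right hχ1, MulChar.map_zero, zero_mul]
  · have hshift := gaussSum_mulShift χ ZMod.stdAddChar (Units.mk0 _ hc)
    rw [Units.val_mk0] at hshift
    rw [← hbase, ← hshift, ← mul_assoc, ← map_mul]
    have : χ (c * c : ZMod p) = 1 := by
      have := quadraticChar_sq_one' hc
      rw [pow_two] at this
      rw [hχ, MulChar.ringHomComp_apply, this, map_one]
    rw [this, one_mul]

lemma sum_range_mul_of_coprime {M : Type*} [AddCommMonoid M] {a b : ℕ} (ha : 0 < a) (hb : 0 < b)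
    (hab : a.Coprime b) {f : ℕ → M} (hf : ∀ k, f (k % (a * b)) = f k) :
    ∑ k ∈ Finset.range (a * b), f k =
      ∑ x ∈ Finset.range a, ∑ y ∈ Finset.range b, f (b * x + a * y) := by
  have hinj : Set.InjOn (fun z : ℕ × ℕ ↦ (b * z.1 + a * z.2) % (a * b))
      (Finset.range a ×ˢ Finset.range b : Finset (ℕ × ℕ)) := by
    rintro ⟨x, y⟩ h ⟨x', y'⟩ h' he
    simp only [Finset.coe_product, Finset.coe_range, Set.mem_prod, Set.mem_Iio] at h h'
    have he' : b * x + a * y ≡ b * x' + a * y' [MOD a * b] := he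
    have h1 : b * x ≡ b * x' [MOD a] := by
      have := he'.of_mul_right b
      simpa [Nat.ModEq] using this
    have h2 : a * y ≡ a * y' [MOD b] := by
      have := he'.of_mul_left a
      simpa [Nat.ModEq] using this
    have h3 := Nat.ModEq.cancel_left_of_coprime hab h1
    have h4 := Nat.ModEq.cancel_left_of_coprime hab.symm h2
    exact Prod.ext (h3.eq_of_lt_of_lt h.1 h'.1) (h4.eq_of_lt_of_lt h.2 h'.2)
  have himg : (Finset.range a ×ˢ Finset.range b).image
      (fun z : ℕ × ℕ ↦ (b * z.1 + a * z.2) % (a * b)) = Finset.range (a * b) := by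
    refine Finset.eq_of_subset_of_card_le (Finset.image_subset_iff.mpr fun z _ ↦
      Finset.mem_range.mpr (Nat.mod_lt _ (Nat.mul_pos ha hb))) ?_
    rw [Finset.card_image_of_injOn hinj, Finset.card_product]
    simp
  rw [← himg, Finset.sum_image hinj, Finset.sum_product]
  simp_rw [hf]

lemma jacobiSym_mul_mul_gaussFactor {a b : ℕ} (ha : Odd a) (hb : Odd b) (hab : a.Coprime b) :
    (jacobiSym b a * jacobiSym a b : ℂ) * (gaussFactor a * gaussFactor b) = gaussFactor (a * b) := by
  have hq := jacobiSym.quadratic_reciprocity_if (Nat.odd_iff.mp ha) (Nat.odd_iff.mp hb)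
  have hs : (jacobiSym b a : ℂ) * jacobiSym b a = 1 := by
    have := jacobiSym.sq_one (a := (b : ℤ)) (b := a) (by simpa [Int.gcd_natCast_natCast] using hab.symm)
    rw [← pow_two]; exact_mod_cast this
  rw [← hq]
  have ha2 := Nat.odd_iff.mp ha
  have hb2 := Nat.odd_iff.mp hb
  have ha4 : a % 4 = 1 ∨ a % 4 = 3 := by omega
  have hb4 : b % 4 = 1 ∨ b % 4 = 3 := by omega
  simp only [gaussFactor, Nat.mul_mod a b 4]
  rcases ha4 with h | h <;> rcases hb4 with h' | h' <;> simp [h, h', hs]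

/-- **Gauss sums of Jacobi symbols** for odd squarefree moduli. -/
theorem sum_jacobiSym_mul_exp (m : ℕ) (hodd : Odd m) (hsf : Squarefree m) (c : ℤ) :
    ∑ k ∈ Finset.range m, (jacobiSym k m : ℂ) * exp (2 * Real.pi * I * (c * k : ℤ) / m) =
      jacobiSym c m * (gaussFactor m * Real.sqrt m) := by
  induction m using induction_on_primes with
  | zero => simp at hodd
  | one => simp [gaussFactor]
  | prime_mul p a hp ih =>
    have : Fact p.Prime := ⟨hp⟩
    have hcop := Nat.coprime_of_squarefree_mul hsf
    obtain ⟨hpo, hao⟩ := Nat.odd_mul.mp hodd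
    have hp2 : p ≠ 2 := by rintro rfl; exact absurd hpo (by decide)
    have ha0 := hao.pos
    have : NeZero a := ⟨ha0.ne'⟩
    have hpC : (p : ℂ) ≠ 0 := by exact_mod_cast hp.ne_zero
    have haC : (a : ℂ) ≠ 0 := by exact_mod_cast ha0.ne'
    specialize ih hao (hsf.of_mul_right)
    have hper (k : ℕ) : (jacobiSym (k % (p * a) : ℕ) (p * a) : ℂ) *
        exp (2 * Real.pi * I * (c * (k % (p * a) : ℕ) : ℤ) / (p * a : ℕ)) =
        (jacobiSym k (p * a) : ℂ) * exp (2 * Real.pi * I * (c * k : ℤ) / (p * a : ℕ)) := by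
      congr 1
      · rw [jacobiSym.mod_left k]; push_cast; rfl
      · refine exp_eq_exp_iff_exists_int.mpr ⟨-(c * (k / (p * a) : ℕ)), ?_⟩
        have hk : (k : ℂ) = (p * a) * (k / (p * a) : ℕ) + (k % (p * a) : ℕ) := by
          exact_mod_cast (Nat.div_add_mod k (p * a)).symm
        simp only [Int.cast_mul, Int.cast_neg, Int.cast_natCast, Nat.cast_mul]
        rw [hk]
        field_simp
        ring
    rw [sum_range_mul_of_coprime hp.pos ha0 hcop hper]
    have hterm (x y : ℕ) : (jacobiSym (a * x + p * y : ℕ) (p * a) : ℂ) *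
        exp (2 * Real.pi * I * (c * (a * x + p * y : ℕ) : ℤ) / (p * a : ℕ)) =
        (jacobiSym a p * jacobiSym p a : ℂ) *
          (((jacobiSym x p : ℂ) * exp (2 * Real.pi * I * (c * x : ℤ) / p)) *
          ((jacobiSym y a : ℂ) * exp (2 * Real.pi * I * (c * y : ℤ) / a))) := by
      have h1 : jacobiSym (a * x + p * y : ℕ) p = jacobiSym a p * jacobiSym x p := by
        rw [← jacobiSym.mul_left]
        exact jacobiSym.mod_left' (by push_cast; simp)
      have h2 : jacobiSym (a * x + p * y : ℕ) a = jacobiSym p a * jacobiSym y a := by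
        rw [← jacobiSym.mul_left]
        exact jacobiSym.mod_left' (by push_cast; simp)
      have h3 : exp (2 * Real.pi * I * (c * (a * x + p * y : ℕ) : ℤ) / (p * a : ℕ)) =
          exp (2 * Real.pi * I * (c * x : ℤ) / p) * exp (2 * Real.pi * I * (c * y : ℤ) / a) := by
        rw [← exp_add]
        congr 1
        push_cast
        field_simp
      have : NeZero p := ⟨hp.ne_zero⟩
      rw [jacobiSym.mul_right, h1, h2, h3]
      push_cast
      ring
    simp_rw [hterm, ← Finset.mul_sum, ← Finset.sum_mul]
    rw [ih, sum_legendre_mul_exp p hp2 c, ← jacobiSym_mul_mul_gaussFactor hpo hao hcop,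
      jacobiSym.mul_right, Nat.cast_mul, Real.sqrt_mul (Nat.cast_nonneg p)]
    push_cast
    ring

end JacobiGaussSum

/-- For `m ≡ 1 [MOD 4]` the Gauss sum of the Jacobi symbol folds onto half of the residues. -/
lemma sum_Icc_jacobiSym_mul_exp_add_exp_neg {m : ℕ} (hm : 1 < m) (hm4 : m % 4 = 1) (c : ℤ) :
    ∑ k ∈ Finset.Icc 1 ((m - 1) / 2), (jacobiSym k m : ℂ) *
        (exp (2 * Real.pi * I * (c * k : ℤ) / m) + exp (-(2 * Real.pi * I * (c * k : ℤ) / m))) =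
      ∑ k ∈ Finset.range m, (jacobiSym k m : ℂ) * exp (2 * Real.pi * I * (c * k : ℤ) / m) := by
  obtain ⟨h, rfl⟩ : ∃ h, m = 2 * h + 1 := ⟨m / 2, by omega⟩
  have hodd : Odd (2 * h + 1) := ⟨h, rfl⟩
  set f : ℕ → ℂ := fun k ↦ (jacobiSym k (2 * h + 1) : ℂ) *
    exp (2 * Real.pi * I * (c * k : ℤ) / (2 * h + 1 : ℕ)) with hf
  have hrefl (k : ℕ) (hk : k ≤ 2 * h + 1) : f (2 * h + 1 - k) = (jacobiSym k (2 * h + 1) : ℂ) *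
      exp (-(2 * Real.pi * I * (c * k : ℤ) / (2 * h + 1 : ℕ))) := by
    have hJ : jacobiSym ((2 * h + 1 - k : ℕ) : ℤ) (2 * h + 1) = jacobiSym k (2 * h + 1) := by
      rw [Nat.cast_sub hk, jacobiSym.mod_left' (a₂ := -(k : ℤ)) (by
        rw [sub_eq_neg_add, Int.add_emod_right]), jacobiSym.neg _ hodd,
        ZMod.χ₄_nat_one_mod_four hm4, one_mul]
    have hne : ((2 * h + 1 : ℕ) : ℂ) ≠ 0 := by exact_mod_cast (by omega : 2 * h + 1 ≠ 0)
    simp only [hf]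
    rw [hJ]
    congr 1
    rw [exp_eq_exp_iff_exists_int]
    refine ⟨c, ?_⟩
    rw [Nat.cast_sub hk]
    field_simp
    push_cast
    ring
  have h0 : f 0 = 0 := by simp [hf, jacobiSym.zero_left hm]
  change _ = ∑ k ∈ Finset.range (2 * h + 1), f k
  rw [show (2 * h + 1 - 1) / 2 = h by omega, Finset.sum_range_succ', h0, add_zero, two_mul,
    Finset.sum_range_add, ← Finset.sum_range_reflect (fun x ↦ f (h + x + 1)),
    ← Finset.sum_add_distrib, Finset.range_eq_Ico, Finset.sum_Ico_eq_sum_range,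
    ← Finset.Ico_succ_right_eq_Icc, Finset.sum_Ico_eq_sum_range]
  refine Finset.sum_congr (by simp) fun k hk ↦ ?_
  have hk : k < h := by simpa using hk
  rw [show h + (h - 1 - (0 + k)) + 1 = 2 * h + 1 - (1 + k) by omega, hrefl _ (by omega), mul_add,
    zero_add, add_comm k 1, ← two_mul]

theorem statement9 (τ : ℂ) (hτ : 0 < τ.im) (m : ℕ) (hm : 1 < m)
    (hsf : Squarefree m) (hm4 : m % 4 = 1) :
    (∏' n : ℕ, (1 - qq τ ^ (n + 1))) *
      ∑ k ∈ Finset.Icc 1 ((m - 1) / 2),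
        (jacobiSym (k : ℤ) m : ℂ) * theta1 (4 * (k : ℂ) * piC / (m : ℂ)) τ /
          theta1 (2 * (k : ℂ) * piC / (m : ℂ)) τ =
    (Real.sqrt m : ℂ) * ∑' n : ℤ, (-1 : ℂ) ^ n * (jacobiSym (6 * n + 1) m : ℂ) *
      exp (piC * I * τ * (n : ℂ) * (3 * (n : ℂ) + 1)) := by
  have hodd : Odd m := Nat.odd_iff.mpr (by omega)
  have hm0 : (m : ℂ) ≠ 0 := by exact_mod_cast (by omega : m ≠ 0)
  have hexp (k : ℕ) (n : ℤ) : exp (I * (2 * k * piC / m)) ^ n =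
      exp (2 * Real.pi * I * (n * k : ℤ) / m) := by
    rw [← exp_int_mul, piC]
    push_cast
    ring_nf
  have hterm (k : ℕ) (hk : k ∈ Finset.Icc 1 ((m - 1) / 2)) :
      (∏' n : ℕ, (1 - qq τ ^ (n + 1))) * ((jacobiSym (k : ℤ) m : ℂ) *
        theta1 (4 * k * piC / m) τ / theta1 (2 * k * piC / m) τ) =
      ∑' n : ℤ, (jacobiSym (k : ℤ) m : ℂ) * ((-1 : ℂ) ^ n * exp (piC * I * τ * n * (3 * n + 1)) *
        (exp (I * (2 * k * piC / m)) ^ (6 * n + 1) +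
          exp (I * (2 * k * piC / m)) ^ (-(6 * n + 1)))) := by
    rw [Finset.mem_Icc] at hk
    rw [tsum_mul_left, ← tprod_mul_theta1_two_mul_div hτ]
    · rw [show (4 * k * piC / m : ℂ) = 2 * (2 * k * piC / m) by ring]
      ring
    · rw [piC, show I * (2 * k * (Real.pi : ℂ) / m) = ((2 * k * Real.pi / m : ℝ) : ℂ) * I by
        push_cast; ring]
      exact norm_exp_ofReal_mul_I _
    · rw [← zpow_ofNat, hexp, Ne, exp_eq_one_iff]
      rintro ⟨j, hj⟩
      have hpi : (2 * Real.pi * I : ℂ) ≠ 0 := two_pi_I_ne_zero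
      have h2 : (((2 * k : ℤ)) : ℂ) = (j * m : ℤ) := by
        rw [div_eq_iff hm0] at hj
        apply mul_left_cancel₀ hpi
        push_cast at hj ⊢
        linear_combination hj
      have h3 : (2 * k : ℤ) = j * m := by exact_mod_cast h2
      have h4 : (m : ℤ) ∣ (2 * k : ℤ) := ⟨j, by rw [h3, mul_comm]⟩
      have := Int.le_of_dvd (by omega) h4
      omega
  have hsum (k : ℕ) : Summable fun n : ℤ ↦ (jacobiSym (k : ℤ) m : ℂ) *
      ((-1 : ℂ) ^ n * exp (piC * I * τ * n * (3 * n + 1)) *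
        (exp (I * (2 * k * piC / m)) ^ (6 * n + 1) +
          exp (I * (2 * k * piC / m)) ^ (-(6 * n + 1)))) := by
    have hp : ‖exp (piC * I * τ)‖ < 1 := by
      rw [norm_exp, Real.exp_lt_one_iff]
      simp only [piC, mul_re, mul_im, ofReal_re, ofReal_im, I_re, I_im]
      nlinarith [mul_pos Real.pi_pos hτ]
    have H := summable_norm_zpow_quadratic_mul_zpow (exp_ne_zero (piC * I * τ)) hp
      (exp_ne_zero (I * (2 * k * piC / m))) 3 1
    refine (((H 6 1 (by norm_num)).of_norm.add (H (-6) (-1) (by norm_num)).of_norm).congr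
      fun n ↦ ?_).mul_left _
    rw [← mul_add, ← exp_int_mul (piC * I * τ), show -6 * n + -1 = -(6 * n + 1) by ring]
    push_cast
    ring_nf
  rw [Finset.mul_sum, Finset.sum_congr rfl hterm, ← Summable.tsum_finsetSum fun k _ ↦ hsum k,
    ← tsum_mul_left]
  refine tsum_congr fun n ↦ ?_
  have hG := sum_jacobiSym_mul_exp m hodd hsf (6 * n + 1)
  rw [← sum_Icc_jacobiSym_mul_exp_add_exp_neg hm hm4, gaussFactor, if_pos hm4, one_mul] at hG
  rw [show (Real.sqrt m : ℂ) * ((-1 : ℂ) ^ n * (jacobiSym (6 * n + 1) m : ℂ) *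
      exp (piC * I * τ * n * (3 * n + 1))) = (-1 : ℂ) ^ n * exp (piC * I * τ * n * (3 * n + 1)) *
      (jacobiSym (6 * n + 1) m * Real.sqrt m) by ring, ← hG, Finset.mul_sum]
  refine Finset.sum_congr rfl fun k _ ↦ ?_
  rw [zpow_neg, hexp, ← exp_neg]
  ring
end Liu
end
end
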